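/- arXiv:1301.5388 — 2 statements merged into one kernel-verified Lean document; each statement's English description precedes it below -/
import Mathlib

section
/- The function v satisfies the integral identities ∫₀^{π_p/(2a₁^{1/p})} v(t) dt = I_p / a₁^{1/p} and ∫_{π_p/(2a₁^{1/p})}^{π_p} v(t) dt = −a₁^{1/p} I_p / b₁^{2/p}, where I_p = ∫₀^{π_p/2} sin_p t dt. -/
/-- The one-dimensional `p`-Laplacian nonlinearity `φ_p(s) = |s|^{p-2} s`. -/
noncomputable def phi (p s : ℝ) : ℝ := |s| ^ (p - 2) * s

/-- The `p`-analogue of `π`: `π_p = 2π (p-1)^{1/p} / (p sin(π/p))`. -/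
noncomputable def pip (p : ℝ) : ℝ :=
  2 * Real.pi * (p - 1) ^ (1 / p) / (p * Real.sin (Real.pi / p))

open MeasureTheory Set

theorem intervalIntegrable_and_integral_one_sub_rpow {p : ℝ} (hp : 1 < p) :
    IntervalIntegrable (fun s : ℝ => (1 - s ^ p) ^ (-(1 / p))) volume 0 1 ∧
      ∫ s in (0 : ℝ)..1, (1 - s ^ p) ^ (-(1 / p)) = Real.pi / (p * Real.sin (Real.pi / p)) := by
  have hp0 : 0 < p := by linarith
  have hp1 : 1 / p < 1 := by rw [div_lt_one hp0]; exact hp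
  have hip : 0 < 1 / p := by positivity
  set b : ℝ → ℝ := fun y => y ^ (1 / p - 1) * (1 - y) ^ (-(1 / p)) with hb
  have hre1 : (((1 / p : ℝ) : ℂ)).re = 1 / p := Complex.ofReal_re _
  have hre2 : (((1 - 1 / p : ℝ) : ℂ)).re = 1 - 1 / p := Complex.ofReal_re _
  have hcongr : ∀ y ∈ Ioo (0 : ℝ) 1,
      (y : ℂ) ^ (((1 / p : ℝ) : ℂ) - 1) * (1 - (y : ℂ)) ^ (((1 - 1 / p : ℝ) : ℂ) - 1)
        = ((b y : ℝ) : ℂ) := by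
    intro y hy
    simp only [hb]
    rw [Complex.ofReal_mul, Complex.ofReal_cpow hy.1.le, Complex.ofReal_cpow (by linarith [hy.2])]
    push_cast
    congr 2
    ring
  have hconv := Complex.betaIntegral_convergent (u := ((1 / p : ℝ) : ℂ))
    (v := ((1 - 1 / p : ℝ) : ℂ)) (by rw [hre1]; exact hip) (by rw [hre2]; linarith)
  rw [intervalIntegrable_iff_integrableOn_Ioo_of_le zero_le_one] at hconv
  have hconvb : IntegrableOn b (Ioo 0 1) := by
    have := (hconv.congr_fun hcongr measurableSet_Ioo).re
    simpa [IntegrableOn] using this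
  have hval : ∫ y in Ioo (0 : ℝ) 1, b y = Real.pi / Real.sin (Real.pi / p) := by
    have h1 := Complex.betaIntegral_eq_Gamma_mul_div ((1 / p : ℝ) : ℂ) ((1 - 1 / p : ℝ) : ℂ)
      (by rw [hre1]; exact hip) (by rw [hre2]; linarith)
    rw [Complex.betaIntegral, intervalIntegral.integral_of_le zero_le_one,
      integral_Ioc_eq_integral_Ioo, setIntegral_congr_fun measurableSet_Ioo hcongr,
      integral_complex_ofReal, Complex.Gamma_ofReal, Complex.Gamma_ofReal,
      ← Complex.ofReal_add, Complex.Gamma_ofReal] at h1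
    have h2 : ∫ y in Ioo (0 : ℝ) 1, b y
        = Real.Gamma (1 / p) * Real.Gamma (1 - 1 / p) / Real.Gamma (1 / p + (1 - 1 / p)) := by
      exact_mod_cast h1
    rw [h2, Real.Gamma_mul_Gamma_one_sub, show 1 / p + (1 - 1 / p) = 1 by ring, Real.Gamma_one,
      div_one, mul_one_div]
  set g : ℝ → ℝ := (Ioo (0 : ℝ) 1).indicator b with hg
  have hgint : IntegrableOn g (Ioi 0) := by
    rw [hg, IntegrableOn, integrable_indicator_iff measurableSet_Ioo]
    exact hconvb.mono_measure (Measure.restrict_le_self)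
  have hgval : ∫ y in Ioi (0 : ℝ), g y = Real.pi / Real.sin (Real.pi / p) := by
    rw [hg, setIntegral_indicator measurableSet_Ioo,
      inter_eq_self_of_subset_right Ioo_subset_Ioi_self, hval]
  have hcomp : ∀ x ∈ Ioi (0 : ℝ), x ^ (p - 1) * g (x ^ p)
      = (Ioo (0 : ℝ) 1).indicator (fun s : ℝ => (1 - s ^ p) ^ (-(1 / p))) x := by
    intro x hx
    have hx : 0 < x := hx
    by_cases h1 : x < 1
    · have hm : x ^ p ∈ Ioo (0 : ℝ) 1 :=
        ⟨Real.rpow_pos_of_pos hx _, Real.rpow_lt_one hx.le h1 hp0⟩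
      rw [hg, indicator_of_mem hm, indicator_of_mem (show x ∈ Ioo (0 : ℝ) 1 from ⟨hx, h1⟩)]
      simp only [hb]
      rw [← Real.rpow_mul hx.le, ← mul_assoc, ← Real.rpow_add hx,
        show p - 1 + p * (1 / p - 1) = 0 by field_simp; ring, Real.rpow_zero, one_mul]
    · have hm : x ^ p ∉ Ioo (0 : ℝ) 1 := fun h =>
        absurd (Real.one_le_rpow (not_lt.1 h1) hp0.le) (not_le.2 h.2)
      rw [hg, indicator_of_notMem hm,
        indicator_of_notMem (fun h : x ∈ Ioo (0 : ℝ) 1 => h1 h.2), mul_zero]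
  have hI := (integrableOn_Ioi_comp_rpow_iff' g hp0.ne').2 hgint
  simp only [smul_eq_mul] at hI
  have hI' := hI.congr_fun hcomp measurableSet_Ioi
  rw [IntegrableOn, integrable_indicator_iff measurableSet_Ioo, IntegrableOn,
    Measure.restrict_restrict measurableSet_Ioo,
    inter_eq_self_of_subset_left Ioo_subset_Ioi_self] at hI'
  refine ⟨(intervalIntegrable_iff_integrableOn_Ioo_of_le zero_le_one).2 hI', ?_⟩
  have hV := integral_comp_rpow_Ioi_of_pos (g := g) hp0
  simp only [smul_eq_mul, mul_assoc] at hV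
  rw [integral_const_mul, setIntegral_congr_fun measurableSet_Ioi hcomp,
    setIntegral_indicator measurableSet_Ioo,
    inter_eq_self_of_subset_right Ioo_subset_Ioi_self, hgval] at hV
  rw [intervalIntegral.integral_of_le zero_le_one, integral_Ioc_eq_integral_Ioo]
  rw [mul_comm p, ← div_div, ← hV, mul_div_cancel_left₀ _ hp0.ne']

theorem exists_first_zero {f : ℝ → ℝ} (hf : Continuous f) (h0 : 0 < f 0) {R : ℝ}
    (h : ¬ ∀ t ∈ Ico 0 R, 0 < f t) :
    ∃ T, 0 < T ∧ T < R ∧ f T = 0 ∧ ∀ t ∈ Ico 0 T, 0 < f t := by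
  push Not at h
  obtain ⟨t₀, ht₀, hft₀⟩ := h
  have hK : IsCompact (Icc 0 t₀ ∩ {t | f t ≤ 0}) :=
    isCompact_Icc.inter_right (isClosed_le hf continuous_const)
  obtain ⟨T, ⟨⟨hT0, hTt⟩, hfT⟩, hmin⟩ := hK.exists_isLeast ⟨t₀, ⟨ht₀.1, le_rfl⟩, hft₀⟩
  have hfT : f T ≤ 0 := hfT
  have hTpos : 0 < T := by
    rcases hT0.eq_or_lt with h | h
    · rw [← h] at hfT
      linarith
    · exact h
  have hpos : ∀ t ∈ Ico 0 T, 0 < f t := fun t ht => by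
    by_contra hn
    exact absurd (hmin ⟨⟨ht.1, ht.2.le.trans hTt⟩, not_lt.1 hn⟩) (not_le.2 ht.2)
  refine ⟨T, hTpos, hTt.trans_lt ht₀.2, le_antisymm hfT ?_, hpos⟩
  have hcl : closure (Ico 0 T) ⊆ {t | 0 ≤ f t} :=
    closure_minimal (fun t ht => (hpos t ht).le) (isClosed_le continuous_const hf)
  rw [closure_Ico hTpos.ne] at hcl
  exact hcl ⟨hTpos.le, le_rfl⟩

theorem eq_of_hasDerivAt_zero {f : ℝ → ℝ} {T : ℝ} (hf : ContinuousOn f (Icc 0 T))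
    (hf' : ∀ t ∈ Ioo 0 T, HasDerivAt f 0 t) {t : ℝ} (ht : t ∈ Icc 0 T) : f t = f 0 := by
  have := intervalIntegral.integral_eq_sub_of_hasDerivAt_of_le ht.1
    (hf.mono (Icc_subset_Icc_right ht.2)) (fun x hx => hf' x ⟨hx.1, hx.2.trans_le ht.2⟩)
    intervalIntegrable_const
  simp only [intervalIntegral.integral_zero] at this
  linarith

theorem phi_zero (p : ℝ) : phi p 0 = 0 := by simp [phi]

theorem phi_neg (p s : ℝ) : phi p (-s) = -phi p s := by simp [phi]

theorem phi_pos_iff {p s : ℝ} : 0 < phi p s ↔ 0 < s := by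
  rcases lt_trichotomy s 0 with h | rfl | h
  · have : phi p s < 0 := mul_neg_of_pos_of_neg (Real.rpow_pos_of_pos (abs_pos.2 h.ne) _) h
    constructor <;> intro <;> linarith
  · simp [phi]
  · have : 0 < phi p s := mul_pos (Real.rpow_pos_of_pos (abs_pos.2 h.ne') _) h
    simp [h, this]

theorem phi_neg_iff {p s : ℝ} : phi p s < 0 ↔ s < 0 := by
  rw [← neg_pos, ← phi_neg, phi_pos_iff, neg_pos]

theorem phi_mul {p c : ℝ} (hc : 0 < c) (s : ℝ) : phi p (c * s) = c ^ (p - 1) * phi p s := by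
  rw [phi, phi, abs_mul, abs_of_pos hc, Real.mul_rpow hc.le (abs_nonneg _),
    show p - 1 = p - 2 + 1 by ring, Real.rpow_add_one hc.ne']
  ring

theorem abs_phi {p : ℝ} (hp : 1 < p) (s : ℝ) : |phi p s| = |s| ^ (p - 1) := by
  rcases eq_or_ne s 0 with rfl | h
  · rw [phi_zero, abs_zero, Real.zero_rpow (by linarith)]
  · rw [phi, abs_mul, abs_of_nonneg (Real.rpow_nonneg (abs_nonneg _) _),
      show p - 1 = p - 2 + 1 by ring, Real.rpow_add_one (abs_ne_zero.2 h)]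

theorem abs_phi_rpow {p : ℝ} (hp : 1 < p) (s : ℝ) : |phi p s| ^ (p / (p - 1)) = |s| ^ p := by
  have : p - 1 ≠ 0 := by linarith
  rw [abs_phi hp, ← Real.rpow_mul (abs_nonneg _), mul_div_cancel₀ _ this]

theorem phi_conjugate_phi {p : ℝ} (hp : 1 < p) (s : ℝ) : phi (p / (p - 1)) (phi p s) = s := by
  have hp1 : p - 1 ≠ 0 := by linarith
  rcases eq_or_ne s 0 with rfl | h
  · rw [phi_zero, phi_zero]
  · have hs : 0 < |s| := abs_pos.2 h
    rw [phi, abs_phi hp, ← Real.rpow_mul hs.le, phi, ← mul_assoc, ← Real.rpow_add hs,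
      show (p - 1) * (p / (p - 1) - 2) + (p - 2) = 0 by field_simp; ring, Real.rpow_zero, one_mul]

theorem energy_eq {p T : ℝ} (hp : 1 < p) {u u' : ℝ → ℝ}
    (hu : ∀ t, HasDerivAt u (u' t) t) (hc : Continuous fun t => phi p (u' t))
    (hode : ∀ t ∈ Ioo 0 T, HasDerivAt (fun s => phi p (u' s)) (-phi p (u t)) t)
    {t : ℝ} (ht : t ∈ Icc 0 T) :
    (p - 1) * |u' t| ^ p + |u t| ^ p = (p - 1) * |u' 0| ^ p + |u 0| ^ p := by
  have hp1 : 0 < p - 1 := by linarith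
  have hq : 1 < p / (p - 1) := by rw [lt_div_iff₀ hp1]; linarith
  have huc : Continuous u := continuous_iff_continuousAt.2 fun t => (hu t).continuousAt
  simp only [← abs_phi_rpow hp (u' _)]
  refine eq_of_hasDerivAt_zero
    (f := fun t => (p - 1) * |phi p (u' t)| ^ (p / (p - 1)) + |u t| ^ p) ?_ (fun s hs => ?_) ht
  · refine Continuous.continuousOn ?_
    exact (continuous_const.mul (hc.abs.rpow_const fun _ => Or.inr (by linarith))).add
      (huc.abs.rpow_const fun _ => Or.inr (by linarith))
  · have h1 := ((hasDerivAt_abs_rpow (phi p (u' s)) hq).comp s (hode s hs)).const_mul (p - 1)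
    have h2 := (hasDerivAt_abs_rpow (u s) hp).comp s (hu s)
    refine (h1.add h2).congr_deriv ?_
    have h3 := phi_conjugate_phi hp (u' s)
    rw [phi] at h3
    rw [mul_assoc (p / (p - 1)), h3, phi]
    field_simp
    ring

/-- The inverse of `sin_p` on its first quarter period. -/
noncomputable def arcsinp (p x : ℝ) : ℝ := ∫ s in (0 : ℝ)..x, (1 - s ^ p / (p - 1)) ^ (-(1 / p))

theorem intervalIntegrable_and_arcsinp_amplitude {p : ℝ} (hp : 1 < p) :
    IntervalIntegrable (fun s : ℝ => (1 - s ^ p / (p - 1)) ^ (-(1 / p))) volume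
        0 ((p - 1) ^ (1 / p)) ∧
      arcsinp p ((p - 1) ^ (1 / p)) = pip p / 2 := by
  have hp0 : 0 < p := by linarith
  have hp1 : 0 < p - 1 := by linarith
  set M := (p - 1) ^ (1 / p) with hM
  have hM0 : 0 < M := Real.rpow_pos_of_pos hp1 _
  have hMp : M ^ p = p - 1 := by
    rw [hM, ← Real.rpow_mul hp1.le, one_div_mul_cancel hp0.ne', Real.rpow_one]
  have hfun : ∀ s ∈ uIcc 0 M,
      (1 - (M⁻¹ * s) ^ p) ^ (-(1 / p)) = (1 - s ^ p / (p - 1)) ^ (-(1 / p)) := by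
    intro s hs
    rw [uIcc_of_le hM0.le] at hs
    rw [Real.mul_rpow (inv_nonneg.2 hM0.le) hs.1, Real.inv_rpow hM0.le, hMp, inv_mul_eq_div]
  obtain ⟨h1, h2⟩ := intervalIntegrable_and_integral_one_sub_rpow hp
  constructor
  · have h3 := h1.comp_mul_left (c := M⁻¹)
    rw [zero_div, div_inv_eq_mul, one_mul] at h3
    exact h3.congr fun s hs => hfun s (uIoc_subset_uIcc hs)
  · rw [arcsinp, ← intervalIntegral.integral_congr hfun,
      intervalIntegral.integral_comp_mul_left (fun s => (1 - s ^ p) ^ (-(1 / p)))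
        (inv_ne_zero hM0.ne'), mul_zero, inv_mul_cancel₀ hM0.ne', h2, pip, inv_inv, smul_eq_mul]
    ring

theorem rpow_div_lt_one {p x : ℝ} (hp : 1 < p)
    (hx : x ∈ Ico 0 ((p - 1) ^ (1 / p))) : x ^ p / (p - 1) < 1 := by
  have hp1 : 0 < p - 1 := by linarith
  rw [div_lt_one hp1]
  calc x ^ p < ((p - 1) ^ (1 / p)) ^ p := Real.rpow_lt_rpow hx.1 hx.2 (by linarith)
    _ = p - 1 := by
      rw [← Real.rpow_mul hp1.le, one_div_mul_cancel (by linarith), Real.rpow_one]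

theorem continuousOn_arcsinp {p : ℝ} (hp : 1 < p) :
    ContinuousOn (arcsinp p) (Icc 0 ((p - 1) ^ (1 / p))) := by
  have hM0 : 0 < (p - 1) ^ (1 / p) := Real.rpow_pos_of_pos (by linarith) _
  have := intervalIntegral.continuousOn_primitive_interval'
    (intervalIntegrable_and_arcsinp_amplitude hp).1 left_mem_uIcc
  rwa [uIcc_of_le hM0.le] at this

theorem hasDerivAt_arcsinp {p x : ℝ} (hp : 1 < p) (hx : x ∈ Ioo 0 ((p - 1) ^ (1 / p))) :
    HasDerivAt (arcsinp p) ((1 - x ^ p / (p - 1)) ^ (-(1 / p))) x := by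
  have hcont : ∀ y ∈ Ioo 0 ((p - 1) ^ (1 / p)),
      ContinuousAt (fun s : ℝ => (1 - s ^ p / (p - 1)) ^ (-(1 / p))) y := fun y hy =>
    ContinuousAt.rpow_const (continuousAt_const.sub
      ((continuousAt_id.rpow_const (Or.inl hy.1.ne')).div_const _))
      (Or.inl (sub_pos.2 (rpow_div_lt_one hp (Ioo_subset_Ico_self hy))).ne')
  refine intervalIntegral.integral_hasDerivAt_right ?_ ?_ (hcont x hx)
  · refine (intervalIntegrable_and_arcsinp_amplitude hp).1.mono_set ?_
    rw [uIcc_of_le hx.1.le, uIcc_of_le (hx.1.trans hx.2).le]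
    exact Icc_subset_Icc_right hx.2.le
  · exact ContinuousAt.stronglyMeasurableAtFilter isOpen_Ioo hcont x hx

theorem strictMonoOn_arcsinp {p : ℝ} (hp : 1 < p) :
    StrictMonoOn (arcsinp p) (Icc 0 ((p - 1) ^ (1 / p))) := by
  refine strictMonoOn_of_deriv_pos (convex_Icc _ _) (continuousOn_arcsinp hp) fun x hx => ?_
  rw [interior_Icc] at hx
  rw [(hasDerivAt_arcsinp hp hx).deriv]
  exact Real.rpow_pos_of_pos (sub_pos.2 (rpow_div_lt_one hp (Ioo_subset_Ico_self hx))) _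

theorem arcsinp_monotone_arc {p T ε : ℝ} (hp : 1 < p) (hT : 0 < T) (hε : |ε| = 1) {u u' : ℝ → ℝ}
    (hu : ∀ t, HasDerivAt u (u' t) t) (hc : Continuous fun t => phi p (u' t))
    (hode : ∀ t, 0 ≤ u t → HasDerivAt (fun s => phi p (u' s)) (-phi p (u t)) t)
    (hinit : (p - 1) * |u' 0| ^ p + |u 0| ^ p = p - 1)
    (hpos : ∀ t ∈ Ioo 0 T, 0 < u t) (hmono : ∀ t ∈ Ioo 0 T, 0 < ε * u' t) :
    ∀ t ∈ Icc 0 T, u t ∈ Icc 0 ((p - 1) ^ (1 / p)) ∧ (p - 1) * |u' t| ^ p + |u t| ^ p = p - 1 ∧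
      arcsinp p (u t) = arcsinp p (u 0) + ε * t := by
  have hp0 : 0 < p := by linarith
  have hp1 : 0 < p - 1 := by linarith
  set M := (p - 1) ^ (1 / p) with hM
  have hM0 : 0 < M := Real.rpow_pos_of_pos hp1 _
  have hMp : M ^ p = p - 1 := by
    rw [hM, ← Real.rpow_mul hp1.le, one_div_mul_cancel hp0.ne', Real.rpow_one]
  have huc : Continuous u := continuous_iff_continuousAt.2 fun t => (hu t).continuousAt
  have hE : ∀ t ∈ Icc 0 T, (p - 1) * |u' t| ^ p + |u t| ^ p = p - 1 := fun t ht => by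
    rw [energy_eq hp hu hc (fun s hs => hode s (hpos s hs).le) ht, hinit]
  have hnn : ∀ t ∈ Icc 0 T, 0 ≤ u t := by
    have hcl : closure (Ioo 0 T) ⊆ {t | 0 ≤ u t} :=
      closure_minimal (fun t ht => (hpos t ht).le) (isClosed_le continuous_const huc)
    rwa [closure_Ioo hT.ne] at hcl
  have hmem : ∀ t ∈ Icc 0 T, u t ∈ Icc 0 M := fun t ht => by
    refine ⟨hnn t ht, ?_⟩
    rw [← Real.rpow_le_rpow_iff (hnn t ht) hM0.le hp0, hMp]
    have h1 := hE t ht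
    rw [abs_of_nonneg (hnn t ht)] at h1
    have h2 : 0 ≤ (p - 1) * |u' t| ^ p :=
      mul_nonneg hp1.le (Real.rpow_nonneg (abs_nonneg _) _)
    linarith
  intro t ht
  refine ⟨hmem t ht, hE t ht, ?_⟩
  have key := eq_of_hasDerivAt_zero (f := fun t => arcsinp p (u t) - ε * t) (T := T) ?_ ?_ ht
  · simp only [mul_zero, sub_zero] at key
    linarith
  · exact ((continuousOn_arcsinp hp).comp huc.continuousOn hmem).sub
      (continuous_const.mul continuous_id).continuousOn
  · intro s hs
    have hs' : s ∈ Icc 0 T := Ioo_subset_Icc_self hs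
    have hne : u' s ≠ 0 := fun h => by simpa [h] using hmono s hs
    have habs : 0 < |u' s| := abs_pos.2 hne
    have hEs := hE s hs'
    rw [abs_of_pos (hpos s hs)] at hEs
    have hroot : 1 - u s ^ p / (p - 1) = |u' s| ^ p := by
      field_simp
      linarith
    have hlt : u s < M := by
      rw [← Real.rpow_lt_rpow_iff (hnn s hs') hM0.le hp0, hMp]
      have := mul_pos hp1 (Real.rpow_pos_of_pos habs p)
      linarith
    have hd := (hasDerivAt_arcsinp hp ⟨hpos s hs, hlt⟩).comp s (hu s)
    have hd2 := hd.sub ((hasDerivAt_id s).const_mul ε)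
    refine hd2.congr_deriv ?_
    have hu's : u' s = ε * |u' s| := by
      rcases eq_or_eq_neg_of_abs_eq hε with rfl | rfl
      · rw [one_mul, abs_of_pos (by simpa using hmono s hs)]
      · rw [abs_of_neg (by simpa using hmono s hs)]
        ring
    rw [hroot, ← Real.rpow_mul habs.le, show p * -(1 / p) = -1 by field_simp, Real.rpow_neg_one,
      mul_one, sub_eq_zero, inv_mul_eq_div, div_eq_iff habs.ne']
    exact hu's

theorem pip_pos {p : ℝ} (hp : 1 < p) : 0 < pip p := by
  have h0 : 0 < p := by linarith
  have hsin : 0 < Real.sin (Real.pi / p) :=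
    Real.sin_pos_of_pos_of_lt_pi (by positivity) (div_lt_self Real.pi_pos hp)
  have : 0 < (p - 1) ^ (1 / p) := Real.rpow_pos_of_pos (by linarith) _
  have := Real.pi_pos
  rw [pip]
  positivity

theorem arcsinp_zero (p : ℝ) : arcsinp p 0 = 0 := by simp [arcsinp]

theorem arcsinp_rising_arc {p : ℝ} (hp : 1 < p) {u u' : ℝ → ℝ}
    (hu : ∀ t, HasDerivAt u (u' t) t) (hc : Continuous fun t => phi p (u' t))
    (hode : ∀ t, 0 ≤ u t → HasDerivAt (fun s => phi p (u' s)) (-phi p (u t)) t)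
    (h0 : u 0 = 0) (h0' : u' 0 = 1) :
    ∀ t ∈ Icc 0 (pip p / 2), u t ∈ Icc 0 ((p - 1) ^ (1 / p)) ∧ arcsinp p (u t) = t := by
  have hp0 : 0 < p := by linarith
  have huc : Continuous u := continuous_iff_continuousAt.2 fun t => (hu t).continuousAt
  have harc : ∀ T, 0 < T → (∀ t ∈ Ico 0 T, 0 < phi p (u' t)) → ∀ t ∈ Icc 0 T,
      u t ∈ Icc 0 ((p - 1) ^ (1 / p)) ∧ (p - 1) * |u' t| ^ p + |u t| ^ p = p - 1 ∧
        arcsinp p (u t) = t := by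
    intro T hT hy
    have hsm : StrictMonoOn u (Icc 0 T) :=
      strictMonoOn_of_deriv_pos (convex_Icc _ _) huc.continuousOn fun x hx => by
        rw [interior_Icc] at hx
        rw [(hu x).deriv]
        exact phi_pos_iff.1 (hy x (Ioo_subset_Ico_self hx))
    have := arcsinp_monotone_arc hp hT (ε := 1) abs_one hu hc hode
      (by simp [h0, h0', Real.zero_rpow hp0.ne'])
      (fun t ht => by
        simpa [h0] using hsm ⟨le_rfl, hT.le⟩ (Ioo_subset_Icc_self ht) ht.1)
      (fun t ht => by simpa using phi_pos_iff.1 (hy t (Ioo_subset_Ico_self ht)))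
    simpa [h0, arcsinp_zero] using this
  have hpos : ∀ t ∈ Ico 0 (pip p / 2), 0 < phi p (u' t) := by
    by_contra hn
    obtain ⟨T, hT0, hTR, hfT, hT⟩ :=
      exists_first_zero hc (phi_pos_iff.2 (by rw [h0']; exact one_pos)) hn
    obtain ⟨hm, hE, hA⟩ := harc T hT0 hT T ⟨hT0.le, le_rfl⟩
    have hz : u' T = 0 := by rw [← phi_conjugate_phi hp (u' T), hfT, phi_zero]
    rw [hz, abs_zero, Real.zero_rpow hp0.ne', mul_zero, zero_add, abs_of_nonneg hm.1] at hE
    have huT : u T = (p - 1) ^ (1 / p) := by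
      rw [← hE, ← Real.rpow_mul hm.1, mul_one_div_cancel hp0.ne', Real.rpow_one]
    rw [huT, (intervalIntegrable_and_arcsinp_amplitude hp).2] at hA
    linarith
  intro t ht
  obtain ⟨h1, -, h3⟩ := harc _ (by linarith [pip_pos hp]) hpos t ht
  exact ⟨h1, h3⟩

theorem arcsinp_falling_arc {p : ℝ} (hp : 1 < p) {u u' : ℝ → ℝ}
    (hu : ∀ t, HasDerivAt u (u' t) t) (hc : Continuous fun t => phi p (u' t))
    (hode : ∀ t, 0 ≤ u t → HasDerivAt (fun s => phi p (u' s)) (-phi p (u t)) t)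
    (h0 : u 0 = (p - 1) ^ (1 / p)) (h0' : u' 0 = 0) :
    (∀ t ∈ Icc 0 (pip p / 2), u t ∈ Icc 0 ((p - 1) ^ (1 / p)) ∧
      arcsinp p (u t) = pip p / 2 - t) ∧ u (pip p / 2) = 0 ∧ u' (pip p / 2) = -1 := by
  have hp0 : 0 < p := by linarith
  have hp1 : 0 < p - 1 := by linarith
  have hM0 : 0 < (p - 1) ^ (1 / p) := Real.rpow_pos_of_pos hp1 _
  have huc : Continuous u := continuous_iff_continuousAt.2 fun t => (hu t).continuousAt
  have hfall : ∀ T, (∀ t ∈ Ico 0 T, 0 < u t) → ∀ t ∈ Ioc 0 T, u' t < 0 := by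
    intro T hy t ht
    have hsa : StrictAntiOn (fun t => phi p (u' t)) (Icc 0 T) :=
      strictAntiOn_of_deriv_neg (convex_Icc _ _) hc.continuousOn fun x hx => by
        rw [interior_Icc] at hx
        have := hy x (Ioo_subset_Ico_self hx)
        rw [(hode x this.le).deriv, neg_lt_zero]
        exact phi_pos_iff.2 this
    have := hsa ⟨le_rfl, ht.1.le.trans ht.2⟩ (Ioc_subset_Icc_self ht) ht.1
    simp only [h0', phi_zero] at this
    exact phi_neg_iff.1 this
  have harc : ∀ T, 0 < T → (∀ t ∈ Ico 0 T, 0 < u t) → ∀ t ∈ Icc 0 T,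
      u t ∈ Icc 0 ((p - 1) ^ (1 / p)) ∧ (p - 1) * |u' t| ^ p + |u t| ^ p = p - 1 ∧
        arcsinp p (u t) = pip p / 2 - t := by
    intro T hT hy
    have := arcsinp_monotone_arc hp hT (ε := -1) (by simp) hu hc hode
      (by rw [h0, h0', abs_zero, Real.zero_rpow hp0.ne', abs_of_pos hM0, ← Real.rpow_mul hp1.le,
        one_div_mul_cancel hp0.ne', Real.rpow_one, mul_zero, zero_add])
      (fun t ht => hy t (Ioo_subset_Ico_self ht))
      (fun t ht => by simpa using hfall T hy t (Ioo_subset_Ioc_self ht))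
    simpa only [h0, (intervalIntegrable_and_arcsinp_amplitude hp).2, neg_one_mul,
      ← sub_eq_add_neg] using this
  have hpos : ∀ t ∈ Ico 0 (pip p / 2), 0 < u t := by
    by_contra hn
    obtain ⟨T, hT0, hTR, hfT, hT⟩ := exists_first_zero huc (by rw [h0]; exact hM0) hn
    obtain ⟨-, -, hA⟩ := harc T hT0 hT T ⟨hT0.le, le_rfl⟩
    rw [hfT, arcsinp_zero] at hA
    linarith
  have hR : 0 < pip p / 2 := by linarith [pip_pos hp]
  have hend := harc _ hR hpos _ ⟨hR.le, le_rfl⟩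
  have hzero : u (pip p / 2) = 0 :=
    (strictMonoOn_arcsinp hp).injOn hend.1 ⟨le_rfl, hM0.le⟩
      (by rw [hend.2.2, arcsinp_zero, sub_self])
  refine ⟨fun t ht => ?_, hzero, ?_⟩
  · obtain ⟨h1, -, h3⟩ := harc _ hR hpos t ht
    exact ⟨h1, h3⟩
  · have hE := hend.2.1
    rw [hzero, abs_zero, Real.zero_rpow hp0.ne', add_zero, mul_eq_left₀ hp1.ne',
      abs_of_neg (hfall _ hpos _ ⟨hR, le_rfl⟩)] at hE
    have hlt := hfall _ hpos _ ⟨hR, le_rfl⟩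
    have := (Real.rpow_left_inj (neg_nonneg.2 hlt.le) zero_le_one hp0.ne').1
      (by rw [hE, Real.one_rpow])
    linarith

theorem hasDerivAt_phi_rescale {p A c k T : ℝ} (hc : 0 < c) (hk : 0 < k)
    (hAk : A * k ^ p = 1) {v v' : ℝ → ℝ}
    (hode : ∀ t, 0 ≤ v t → HasDerivAt (fun s => phi p (v' s)) (-A * phi p (v t)) t) (t : ℝ)
    (ht : 0 ≤ c * v (T + k * t)) :
    HasDerivAt (fun s => phi p (c * k * v' (T + k * s))) (-phi p (c * v (T + k * t))) t := by
  have hin : HasDerivAt (fun s => T + k * s) k t := by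
    simpa using ((hasDerivAt_id t).const_mul k).const_add T
  have hout :=
    ((hode _ (nonneg_of_mul_nonneg_right ht hc)).comp t hin).const_mul ((c * k) ^ (p - 1))
  simp only [phi_mul (mul_pos hc hk)]
  refine hout.congr_deriv ?_
  have hkp : k ^ (p - 1) * k = k ^ p := by
    rw [← Real.rpow_add_one hk.ne', sub_add_cancel]
  rw [phi_mul hc, Real.mul_rpow hc.le hk.le]
  calc c ^ (p - 1) * k ^ (p - 1) * (-A * phi p (v (T + k * t)) * k)
      = -(A * (k ^ (p - 1) * k)) * (c ^ (p - 1) * phi p (v (T + k * t))) := by ring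
    _ = _ := by rw [hkp, hAk]; ring

theorem hasDerivAt_rescale {c k T : ℝ} {v v' : ℝ → ℝ} (hv : ∀ t, HasDerivAt v (v' t) t) (t : ℝ) :
    HasDerivAt (fun s => c * v (T + k * s)) (c * k * v' (T + k * t)) t := by
  have hin : HasDerivAt (fun s => T + k * s) k t := by
    simpa using ((hasDerivAt_id t).const_mul k).const_add T
  refine (((hv (T + k * t)).comp t hin).const_mul c).congr_deriv ?_
  ring

theorem continuous_phi_rescale {p c k T : ℝ} (hc : 0 < c) (hk : 0 < k) {v' : ℝ → ℝ}
    (hy : Continuous fun t => phi p (v' t)) :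
    Continuous fun t => phi p (c * k * v' (T + k * t)) := by
  simp only [phi_mul (mul_pos hc hk)]
  exact continuous_const.mul
    (hy.comp (continuous_const.add (continuous_const.mul continuous_id)))

/-- With `I_p = ∫₀^{π_p/2} sin_p t dt`, the solution `v` of
`(φ_p(v'))' + a₁ φ_p(v⁺) − b₁ φ_p(v⁻) = 0`, `v(0) = (p−1)^{1/p}`, `v'(0) = 0`,
satisfies `∫₀^{π_p/(2a₁^{1/p})} v = I_p/a₁^{1/p}` and
`∫_{π_p/(2a₁^{1/p})}^{π_p} v = −a₁^{1/p} I_p / b₁^{2/p}`. -/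
theorem integral_identities_for_v
    (p a₁ b₁ : ℝ) (S S' v v' : ℝ → ℝ)
    (hp : 2 ≤ p)
    (ha₁ : 0 < a₁) (hb₁ : 0 < b₁)
    (hab : a₁ ^ (-(1 : ℝ) / p) + b₁ ^ (-(1 : ℝ) / p) = 2)
    -- `S = sin_p`
    (hS : ∀ t, HasDerivAt S (S' t) t)
    (hSode : ∀ t, HasDerivAt (fun s => phi p (S' s)) (-phi p (S t)) t)
    (hS0 : S 0 = 0) (hS'0 : S' 0 = 1)
    (hSper : Function.Periodic S (2 * pip p)) (hSodd : ∀ t, S (-t) = -S t)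
    -- `v`
    (hv : ∀ t, HasDerivAt v (v' t) t)
    (hode : ∀ t, HasDerivAt (fun s => phi p (v' s))
      (-a₁ * phi p (max (v t) 0) + b₁ * phi p (max (-v t) 0)) t)
    (hv0 : v 0 = (p - 1) ^ (1 / p)) (hv'0 : v' 0 = 0) :
    (∫ t in (0 : ℝ)..(pip p / (2 * a₁ ^ (1 / p))), v t
        = (∫ t in (0 : ℝ)..(pip p / 2), S t) / a₁ ^ (1 / p)) ∧
    (∫ t in (pip p / (2 * a₁ ^ (1 / p)))..(pip p), v t
        = -(a₁ ^ (1 / p) * (∫ t in (0 : ℝ)..(pip p / 2), S t)) / b₁ ^ (2 / p)) := by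
  have hp1 : 1 < p := by linarith
  have hp0 : 0 < p := by linarith
  have hpi := pip_pos hp1
  set α := a₁ ^ (1 / p) with hα
  set β := b₁ ^ (1 / p) with hβ
  have hα0 : 0 < α := Real.rpow_pos_of_pos ha₁ _
  have hβ0 : 0 < β := Real.rpow_pos_of_pos hb₁ _
  have hαp : a₁ * α⁻¹ ^ p = 1 := by
    rw [Real.inv_rpow hα0.le, hα, ← Real.rpow_mul ha₁.le, one_div_mul_cancel hp0.ne',
      Real.rpow_one, mul_inv_cancel₀ ha₁.ne']
  have hβp : b₁ * β⁻¹ ^ p = 1 := by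
    rw [Real.inv_rpow hβ0.le, hβ, ← Real.rpow_mul hb₁.le, one_div_mul_cancel hp0.ne',
      Real.rpow_one, mul_inv_cancel₀ hb₁.ne']
  have hβ2 : b₁ ^ (2 / p) = β * β := by
    rw [hβ, ← Real.rpow_add hb₁]
    congr 1
    ring
  have hab' : α⁻¹ + β⁻¹ = 2 := by
    rw [← hab, hα, hβ, neg_div, Real.rpow_neg ha₁.le, Real.rpow_neg hb₁.le]
  have hinj := (strictMonoOn_arcsinp hp1).injOn
  have hSarc := arcsinp_rising_arc hp1 hS
    (continuous_iff_continuousAt.2 fun t => (hSode t).continuousAt) (fun t _ => hSode t) hS0 hS'0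
  have hyc : Continuous fun t => phi p (v' t) :=
    continuous_iff_continuousAt.2 fun t => (hode t).continuousAt
  set T := pip p / (2 * α) with hT
  have hTα : α * T = pip p / 2 := by
    rw [hT]
    field_simp
  have hTβ : β * (pip p - T) = pip p / 2 := by
    have : pip p - T = pip p / 2 * β⁻¹ := by
      rw [eq_sub_of_add_eq' hab', hT]
      field_simp
    rw [this]
    field_simp
  obtain ⟨hfall, hzero, hslope⟩ := arcsinp_falling_arc hp1
    (hasDerivAt_rescale (c := 1) (k := α⁻¹) (T := 0) hv)
    (continuous_phi_rescale one_pos (inv_pos.2 hα0) hyc)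
    (hasDerivAt_phi_rescale one_pos (inv_pos.2 hα0) hαp fun t ht =>
      (hode t).congr_deriv (by
        rw [max_eq_left ht, max_eq_right (neg_nonpos.2 ht), phi_zero, mul_zero, add_zero]))
    (by simpa using hv0) (by simp [hv'0])
  have hscale : 0 + α⁻¹ * (pip p / 2) = T := by
    rw [← hTα]
    field_simp
    ring
  rw [hscale, one_mul] at hzero hslope
  have hpositive : ∀ t ∈ uIcc 0 T, v t = S (pip p / 2 - α * t) := by
    intro t ht
    rw [uIcc_of_le (by positivity)] at ht
    have h1 : α * t ≤ α * T := mul_le_mul_of_nonneg_left ht.2 hα0.le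
    have h2 : 0 ≤ α * t := mul_nonneg hα0.le ht.1
    obtain ⟨hm, hA⟩ := hfall (α * t) ⟨h2, by linarith⟩
    have hsimp : 1 * v (0 + α⁻¹ * (α * t)) = v t := by
      rw [one_mul, zero_add, inv_mul_cancel_left₀ hα0.ne']
    rw [hsimp] at hm hA
    obtain ⟨hm', hA'⟩ := hSarc (pip p / 2 - α * t) ⟨by linarith, by linarith⟩
    exact hinj hm hm' (by rw [hA, hA'])
  have hrise := arcsinp_rising_arc hp1
    (hasDerivAt_rescale (c := β / α) (k := β⁻¹) (T := T) fun t => (hv t).neg)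
    (continuous_phi_rescale (v' := fun t => -v' t) (by positivity) (inv_pos.2 hβ0) (by
      simp only [phi_neg]
      exact hyc.neg))
    (hasDerivAt_phi_rescale (v := fun t => -v t) (v' := fun t => -v' t) (by positivity)
      (inv_pos.2 hβ0) hβp fun t ht => by
      simp only [phi_neg]
      refine (hode t).neg.congr_deriv ?_
      rw [max_eq_left ht, max_eq_right (neg_nonneg.1 ht), phi_zero, phi_neg]
      ring)
    (by simp [hzero]) (by
      rw [mul_zero, add_zero]
      field_simp at hslope ⊢
      linarith)
  have hnegative : ∀ t ∈ uIcc T (pip p), v t = -(α / β) * S (β * t - β * T) := by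
    intro t ht
    have hTle : 0 ≤ pip p - T := by
      have := hTβ ▸ half_pos hpi
      exact (pos_of_mul_pos_right this hβ0.le).le
    rw [uIcc_of_le (by linarith)] at ht
    have h1 : β * (t - T) ≤ β * (pip p - T) :=
      mul_le_mul_of_nonneg_left (by linarith [ht.2]) hβ0.le
    have h2 : 0 ≤ β * (t - T) := mul_nonneg hβ0.le (by linarith [ht.1])
    have hmem : β * t - β * T ∈ Icc 0 (pip p / 2) := by
      rw [← mul_sub]
      exact ⟨h2, by linarith⟩
    obtain ⟨hm, hA⟩ := hrise _ hmem
    obtain ⟨hm', hA'⟩ := hSarc _ hmem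
    have hsimp : T + β⁻¹ * (β * t - β * T) = t := by
      field_simp
      ring
    rw [hsimp] at hm hA
    rw [← hinj hm hm' (by rw [hA, hA']), Pi.neg_apply]
    field_simp
  constructor
  · rw [intervalIntegral.integral_congr hpositive,
      intervalIntegral.integral_comp_sub_mul S hα0.ne', hTα, mul_zero, sub_self, sub_zero,
      smul_eq_mul, inv_mul_eq_div]
  · rw [intervalIntegral.integral_congr hnegative, intervalIntegral.integral_const_mul,
      intervalIntegral.integral_comp_mul_sub S hβ0.ne', sub_self, ← mul_sub, hTβ, hβ2, smul_eq_mul]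
    field_simp
end

section
/- Suppose R(h,t,θ) satisfies the implicit equation R = ω f₁(ωh − R, t, θ) − ω^p d^{1/p} (ωh − R)^{1/p} v(θ) f(t) together with |R(h,t,θ)| ≤ ωh/2 for all sufficiently large h, where f₁(r,θ,t) = ω^{p-1}G(d^{1/p} r^{1/p} v(θ), t). Then there exist constants C' > 0 and h₀ such that |D_h^i D_t^j R(h,t,θ)| ≤ C' · h^{n(i)} for all 0 ≤ i+j ≤ 21, all θ, all t, and all h ≥ h₀, where n(0) = 1/p and n(i) = −i/q for i ≥ 1. -/
/-- Mixed partial derivative `D_x^i D_t^j F(x,t)` of a function of two real variables. -/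
noncomputable def iterD (F : ℝ → ℝ → ℝ) (i j : ℕ) (x t : ℝ) : ℝ :=
  iteratedDeriv i (fun y => iteratedDeriv j (F y) t) x

/-- The exponent `n(i)`: `n(0) = 1/p`, `n(i) = −i/q` for `i ≥ 1`. -/
noncomputable def nExp (p q : ℝ) (i : ℕ) : ℝ := if i = 0 then 1 / p else -(i : ℝ) / q

/-- Symbol class of order `n` with weights `w`: all partial derivatives of `F θ h t` of total order
at most `n`, with `i` of them in `h`, are `O(h ^ w i)` uniformly in `θ`, `t` and `h > h₀`. -/
def IsSymbol (h₀ : ℝ) : ℕ → (ℕ → ℝ) → (ℝ → ℝ → ℝ → ℝ) → Prop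
  | 0, w, F => ∃ C : ℝ, ∀ θ h t, h₀ < h → |F θ h t| ≤ C * h ^ w 0
  | n + 1, w, F => (∃ C : ℝ, ∀ θ h t, h₀ < h → |F θ h t| ≤ C * h ^ w 0) ∧
      ∃ Fh Ft : ℝ → ℝ → ℝ → ℝ,
        (∀ θ h t, h₀ < h → HasDerivAt (fun s => F θ s t) (Fh θ h t) h) ∧
        (∀ θ h t, h₀ < h → HasDerivAt (fun s => F θ h s) (Ft θ h t) t) ∧
        IsSymbol h₀ n (fun i => w (i + 1)) Fh ∧ IsSymbol h₀ n w Ft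

namespace IsSymbol

variable {h₀ : ℝ} {n : ℕ} {w w₁ w₂ : ℕ → ℝ} {F F₁ F₂ : ℝ → ℝ → ℝ → ℝ}

theorem bound (hF : IsSymbol h₀ n w F) :
    ∃ C : ℝ, ∀ θ h t, h₀ < h → |F θ h t| ≤ C * h ^ w 0 := by
  cases n with
  | zero => exact hF
  | succ n => exact hF.1

theorem congr (hF : IsSymbol h₀ n w F₁) (h : ∀ θ h t, h₀ < h → F₂ θ h t = F₁ θ h t) :
    IsSymbol h₀ n w F₂ := by
  have hb : ∃ C : ℝ, ∀ θ h t, h₀ < h → |F₂ θ h t| ≤ C * h ^ w 0 := by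
    obtain ⟨C, hC⟩ := hF.bound
    exact ⟨C, fun θ x t hx => by rw [h θ x t hx]; exact hC θ x t hx⟩
  cases n with
  | zero => exact hb
  | succ n =>
    obtain ⟨-, Fh, Ft, h1, h2, h3, h4⟩ := hF
    refine ⟨hb, Fh, Ft, fun θ x t hx => ?_, fun θ x t hx => ?_, h3, h4⟩
    · refine (h1 θ x t hx).congr_of_eventuallyEq ?_
      filter_upwards [lt_mem_nhds hx] with s hs using h θ s t hs
    · refine (h2 θ x t hx).congr_of_eventuallyEq ?_
      exact Filter.Eventually.of_forall fun s => h θ x s hx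

theorem of_succ (hF : IsSymbol h₀ (n + 1) w F) : IsSymbol h₀ n w F := by
  induction n generalizing w F with
  | zero => exact hF.1
  | succ n ih =>
    obtain ⟨hb, Fh, Ft, h1, h2, h3, h4⟩ := hF
    exact ⟨hb, Fh, Ft, h1, h2, ih h3, ih h4⟩

theorem mono (h1 : 1 ≤ h₀) (hw : ∀ i, w₁ i ≤ w₂ i) (hF : IsSymbol h₀ n w₁ F) :
    IsSymbol h₀ n w₂ F := by
  have hb : ∀ {w₁ w₂ : ℕ → ℝ} {F : ℝ → ℝ → ℝ → ℝ}, (∀ i, w₁ i ≤ w₂ i) →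
      (∃ C : ℝ, ∀ θ h t, h₀ < h → |F θ h t| ≤ C * h ^ w₁ 0) →
      ∃ C : ℝ, ∀ θ h t, h₀ < h → |F θ h t| ≤ C * h ^ w₂ 0 := by
    rintro w₁ w₂ F hw ⟨C, hC⟩
    refine ⟨|C|, fun θ h t hh => (hC θ h t hh).trans ?_⟩
    have : h ^ w₁ 0 ≤ h ^ w₂ 0 := Real.rpow_le_rpow_of_exponent_le (by linarith) (hw 0)
    have h0 : (0 : ℝ) ≤ h ^ w₁ 0 := Real.rpow_nonneg (by linarith) _
    calc C * h ^ w₁ 0 ≤ |C| * h ^ w₁ 0 := by gcongr; exact le_abs_self C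
      _ ≤ _ := by gcongr
  induction n generalizing w₁ w₂ F with
  | zero => exact hb hw hF
  | succ n ih =>
    obtain ⟨hb', Fh, Ft, h1, h2, h3, h4⟩ := hF
    exact ⟨hb hw hb', Fh, Ft, h1, h2, ih (fun i => hw (i + 1)) h3, ih hw h4⟩

theorem add (hF₁ : IsSymbol h₀ n w F₁) (hF₂ : IsSymbol h₀ n w F₂) :
    IsSymbol h₀ n w (fun θ h t => F₁ θ h t + F₂ θ h t) := by
  have hb : ∃ C : ℝ, ∀ θ h t, h₀ < h → |F₁ θ h t + F₂ θ h t| ≤ C * h ^ w 0 := by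
    obtain ⟨C, hC⟩ := hF₁.bound
    obtain ⟨D, hD⟩ := hF₂.bound
    refine ⟨C + D, fun θ h t hh => (abs_add_le _ _).trans ?_⟩
    rw [add_mul]
    exact add_le_add (hC θ h t hh) (hD θ h t hh)
  induction n generalizing w F₁ F₂ with
  | zero => exact hb
  | succ n ih =>
    obtain ⟨-, Fh, Ft, h1, h2, h3, h4⟩ := hF₁
    obtain ⟨-, Gh, Gt, k1, k2, k3, k4⟩ := hF₂
    refine ⟨hb, fun θ h t => Fh θ h t + Gh θ h t, fun θ h t => Ft θ h t + Gt θ h t,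
      fun θ h t hh => (h1 θ h t hh).add (k1 θ h t hh),
      fun θ h t hh => (h2 θ h t hh).add (k2 θ h t hh), ih h3 k3 ?_, ih h4 k4 ?_⟩
    · obtain ⟨C, hC⟩ := h3.bound
      obtain ⟨D, hD⟩ := k3.bound
      refine ⟨C + D, fun θ h t hh => (abs_add_le _ _).trans ?_⟩
      rw [add_mul]
      exact add_le_add (hC θ h t hh) (hD θ h t hh)
    · obtain ⟨C, hC⟩ := h4.bound
      obtain ⟨D, hD⟩ := k4.bound
      refine ⟨C + D, fun θ h t hh => (abs_add_le _ _).trans ?_⟩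
      rw [add_mul]
      exact add_le_add (hC θ h t hh) (hD θ h t hh)

theorem mul (h1 : 1 ≤ h₀) (hw : ∀ i j, w₁ i + w₂ j ≤ w (i + j))
    (hF₁ : IsSymbol h₀ n w₁ F₁) (hF₂ : IsSymbol h₀ n w₂ F₂) :
    IsSymbol h₀ n w (fun θ h t => F₁ θ h t * F₂ θ h t) := by
  have hb : ∀ {w w₁ w₂ : ℕ → ℝ} {F₁ F₂ : ℝ → ℝ → ℝ → ℝ}, (∀ i j, w₁ i + w₂ j ≤ w (i + j)) →
      (∃ C : ℝ, ∀ θ h t, h₀ < h → |F₁ θ h t| ≤ C * h ^ w₁ 0) →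
      (∃ C : ℝ, ∀ θ h t, h₀ < h → |F₂ θ h t| ≤ C * h ^ w₂ 0) →
      ∃ C : ℝ, ∀ θ h t, h₀ < h → |F₁ θ h t * F₂ θ h t| ≤ C * h ^ w 0 := by
    rintro w w₁ w₂ F₁ F₂ hw ⟨C, hC⟩ ⟨D, hD⟩
    refine ⟨|C| * |D|, fun θ h t hh => ?_⟩
    have hpos : 0 < h := by linarith
    have e : h ^ w₁ 0 * h ^ w₂ 0 ≤ h ^ w 0 := by
      rw [← Real.rpow_add hpos]
      exact Real.rpow_le_rpow_of_exponent_le (by linarith) (hw 0 0)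
    have p1 : 0 ≤ h ^ w₁ 0 := Real.rpow_nonneg hpos.le _
    have p2 : 0 ≤ h ^ w₂ 0 := Real.rpow_nonneg hpos.le _
    have b1 : |F₁ θ h t| ≤ |C| * h ^ w₁ 0 :=
      (hC θ h t hh).trans (mul_le_mul_of_nonneg_right (le_abs_self C) p1)
    have b2 : |F₂ θ h t| ≤ |D| * h ^ w₂ 0 :=
      (hD θ h t hh).trans (mul_le_mul_of_nonneg_right (le_abs_self D) p2)
    rw [abs_mul]
    calc |F₁ θ h t| * |F₂ θ h t| ≤ (|C| * h ^ w₁ 0) * (|D| * h ^ w₂ 0) := by gcongr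
      _ = |C| * |D| * (h ^ w₁ 0 * h ^ w₂ 0) := by ring
      _ ≤ _ := by gcongr
  induction n generalizing w w₁ w₂ F₁ F₂ with
  | zero => exact hb hw hF₁ hF₂
  | succ n ih =>
    have s1 := hF₁.of_succ
    have s2 := hF₂.of_succ
    obtain ⟨b1, Fh, Ft, h1, h2, h3, h4⟩ := hF₁
    obtain ⟨b2, Gh, Gt, k1, k2, k3, k4⟩ := hF₂
    refine ⟨hb hw b1 b2, fun θ h t => Fh θ h t * F₂ θ h t + F₁ θ h t * Gh θ h t,
      fun θ h t => Ft θ h t * F₂ θ h t + F₁ θ h t * Gt θ h t,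
      fun θ h t hh => (h1 θ h t hh).mul (k1 θ h t hh),
      fun θ h t hh => (h2 θ h t hh).mul (k2 θ h t hh),
      (ih (fun i j => ?_) h3 s2).add (ih (fun i j => ?_) s1 k3), (ih hw h4 s2).add (ih hw s1 k4)⟩
    · have := hw (i + 1) j
      rwa [add_right_comm] at this
    · exact hw i (j + 1)

theorem zero : IsSymbol h₀ n w (fun _ _ _ => 0) := by
  induction n generalizing w with
  | zero => exact ⟨0, fun θ h t _ => by simp⟩
  | succ n ih =>
    exact ⟨⟨0, fun θ h t _ => by simp⟩, fun _ _ _ => 0, fun _ _ _ => 0,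
      fun θ h t _ => hasDerivAt_const _ _, fun θ h t _ => hasDerivAt_const _ _, ih, ih⟩

theorem of_iteratedDeriv_bounded (h1 : 1 ≤ h₀) (hw : 0 ≤ w 0) {v g : ℝ → ℝ} {V : ℝ}
    (hv : ∀ θ, |v θ| ≤ V) (hg : ContDiff ℝ n g)
    (hgb : ∀ k ≤ n, ∃ C, ∀ t, |iteratedDeriv k g t| ≤ C) :
    IsSymbol h₀ n w (fun θ _ t => v θ * g t) := by
  have hb : ∀ {g : ℝ → ℝ}, (∃ C, ∀ t, |g t| ≤ C) →
      ∃ C : ℝ, ∀ θ h t, h₀ < h → |v θ * g t| ≤ C * h ^ w 0 := by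
    rintro g ⟨C, hC⟩
    refine ⟨V * C, fun θ h t hh => ?_⟩
    have V0 : 0 ≤ V := (abs_nonneg _).trans (hv 0)
    have C0 : 0 ≤ C := (abs_nonneg _).trans (hC 0)
    rw [abs_mul]
    calc |v θ| * |g t| ≤ V * C := mul_le_mul (hv θ) (hC t) (abs_nonneg _) V0
      _ ≤ V * C * h ^ w 0 :=
        le_mul_of_one_le_right (by positivity) (Real.one_le_rpow (by linarith) hw)
  induction n generalizing g with
  | zero => exact hb (by simpa using hgb 0 le_rfl)
  | succ n ih =>
    rw [Nat.cast_succ, contDiff_succ_iff_deriv] at hg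
    refine ⟨hb (by simpa using hgb 0 (Nat.zero_le _)), fun _ _ _ => 0, fun θ _ t => v θ * deriv g t,
      fun θ h t _ => hasDerivAt_const _ _,
      fun θ h t _ => (hg.1 t).hasDerivAt.const_mul _, zero, ih hg.2.2 fun k hk => ?_⟩
    have := hgb (k + 1) (by omega)
    rwa [iteratedDeriv_succ'] at this

theorem const (h1 : 1 ≤ h₀) (hw : 0 ≤ w 0) {v : ℝ → ℝ} {V : ℝ} (hv : ∀ θ, |v θ| ≤ V) :
    IsSymbol h₀ n w (fun θ _ _ => v θ) := by
  induction n with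
  | zero =>
    refine ⟨V, fun θ h t hh => (hv θ).trans ?_⟩
    exact le_mul_of_one_le_right ((abs_nonneg _).trans (hv 0))
      (Real.one_le_rpow (by linarith) hw)
  | succ n ih =>
    refine ⟨⟨V, fun θ h t hh => (hv θ).trans ?_⟩, fun _ _ _ => 0, fun _ _ _ => 0,
      fun θ h t _ => hasDerivAt_const _ _, fun θ h t _ => hasDerivAt_const _ _, zero, zero⟩
    exact le_mul_of_one_le_right ((abs_nonneg _).trans (hv 0))
      (Real.one_le_rpow (by linarith) hw)

theorem iterD_bound {i j : ℕ} (hij : i + j ≤ n) (hF : IsSymbol h₀ n w F) :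
    ∃ C : ℝ, ∀ θ h t, h₀ < h → |iterD (F θ) i j h t| ≤ C * h ^ w i := by
  unfold iterD
  induction n generalizing i j w F with
  | zero =>
    obtain ⟨rfl, rfl⟩ : i = 0 ∧ j = 0 := by omega
    simpa using hF.bound
  | succ n ih =>
    cases j with
    | succ j =>
      obtain ⟨-, Fh, Ft, -, h2, -, h4⟩ := hF
      obtain ⟨C, hC⟩ := ih (i := i) (j := j) (by omega) h4
      refine ⟨C, fun θ h t hh => ?_⟩
      have : (fun y => iteratedDeriv (j + 1) (F θ y) t) =ᶠ[nhds h]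
          fun y => iteratedDeriv j (Ft θ y) t := by
        filter_upwards [lt_mem_nhds hh] with s hs
        rw [iteratedDeriv_succ']
        congr 1
        funext x
        exact (h2 θ s x hs).deriv
      rw [this.iteratedDeriv_eq]
      exact hC θ h t hh
    | zero =>
      cases i with
      | zero => simpa using hF.bound
      | succ i =>
        obtain ⟨-, Fh, Ft, h1, -, h3, -⟩ := hF
        obtain ⟨C, hC⟩ := ih (i := i) (j := 0) (by omega) h3
        refine ⟨C, fun θ h t hh => ?_⟩
        have : deriv (fun y => iteratedDeriv 0 (F θ y) t) =ᶠ[nhds h]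
            fun y => iteratedDeriv 0 (Fh θ y) t := by
          filter_upwards [lt_mem_nhds hh] with s hs
          simpa using (h1 θ s t hs).deriv
        rw [iteratedDeriv_succ', this.iteratedDeriv_eq]
        exact hC θ h t hh

end IsSymbol

/-- Affine weights `a - i δ`. -/
def affineWeight (δ a : ℝ) (i : ℕ) : ℝ := a - i * δ

theorem affineWeight_succ (δ a : ℝ) :
    (fun i => affineWeight δ a (i + 1)) = affineWeight δ (a - δ) := by
  funext i
  simp only [affineWeight]
  push_cast
  ring

theorem affineWeight_zero (δ a : ℝ) : affineWeight δ a 0 = a := by simp [affineWeight]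

namespace IsSymbol

variable {h₀ δ a b c : ℝ} {n : ℕ} {F F₁ F₂ : ℝ → ℝ → ℝ → ℝ}

theorem mono_affine (h1 : 1 ≤ h₀) (hab : a ≤ b) (hF : IsSymbol h₀ n (affineWeight δ a) F) :
    IsSymbol h₀ n (affineWeight δ b) F :=
  hF.mono h1 fun i => by simp only [affineWeight]; linarith

theorem mul_affine (h1 : 1 ≤ h₀) (habc : a + b ≤ c) (hF₁ : IsSymbol h₀ n (affineWeight δ a) F₁)
    (hF₂ : IsSymbol h₀ n (affineWeight δ b) F₂) :
    IsSymbol h₀ n (affineWeight δ c) (fun θ h t => F₁ θ h t * F₂ θ h t) :=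
  hF₁.mul h1 (fun i j => by simp only [affineWeight]; push_cast; linarith) hF₂

theorem const_mul (h1 : 1 ≤ h₀) {v : ℝ → ℝ} {V : ℝ} (hv : ∀ θ, |v θ| ≤ V)
    (hF : IsSymbol h₀ n (affineWeight δ a) F) :
    IsSymbol h₀ n (affineWeight δ a) (fun θ h t => v θ * F θ h t) :=
  (const h1 (affineWeight_zero δ 0).ge hv).mul_affine h1 (zero_add a).le hF

theorem inv (h1 : 1 ≤ h₀) (hc : 0 < c) (hpos : ∀ θ h t, h₀ < h → c * h ^ a ≤ F θ h t)
    (hF : IsSymbol h₀ n (affineWeight δ a) F) :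
    IsSymbol h₀ n (affineWeight δ (-a)) (fun θ h t => (F θ h t)⁻¹) := by
  have hF0 : ∀ θ h t, h₀ < h → 0 < F θ h t := fun θ h t hh =>
    (mul_pos hc (Real.rpow_pos_of_pos (by linarith) _)).trans_le (hpos θ h t hh)
  have hb : ∃ C : ℝ, ∀ θ h t, h₀ < h → |(F θ h t)⁻¹| ≤ C * h ^ affineWeight δ (-a) 0 := by
    refine ⟨c⁻¹, fun θ h t hh => ?_⟩
    have hh0 : 0 < h := by linarith
    have : 0 < h ^ a := Real.rpow_pos_of_pos hh0 _
    rw [affineWeight_zero, Real.rpow_neg hh0.le, ← mul_inv, abs_of_pos (inv_pos.2 (hF0 θ h t hh))]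
    exact inv_anti₀ (by positivity) (hpos θ h t hh)
  induction n with
  | zero => exact hb
  | succ n ih =>
    have hi := ih hF.of_succ
    obtain ⟨-, Fh, Ft, k1, k2, k3, k4⟩ := hF
    rw [affineWeight_succ] at k3
    have hi2 := hi.mul_affine h1 le_rfl hi
    refine ⟨hb, _, _, fun θ h t hh => (k1 θ h t hh).inv (hF0 θ h t hh).ne',
      fun θ h t hh => (k2 θ h t hh).inv (hF0 θ h t hh).ne', ?_, ?_⟩
    · rw [affineWeight_succ]
      refine ((const_mul h1 (v := fun _ => -1) (fun _ => le_rfl) k3).mul_affine h1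
        (c := -a - δ) (by linarith) hi2).congr fun θ h t hh => ?_
      have := (hF0 θ h t hh).ne'
      field_simp
    · refine ((const_mul h1 (v := fun _ => -1) (fun _ => le_rfl) k4).mul_affine h1
        (c := -a) (by linarith) hi2).congr fun θ h t hh => ?_
      have := (hF0 θ h t hh).ne'
      field_simp

end IsSymbol

/-- `H` is `n` times differentiable with all partial derivatives of order at most `n` bounded. -/
def HasBoundedPartials : ℕ → (ℝ × ℝ → ℝ) → Prop
  | 0, H => ∃ C : ℝ, ∀ z, |H z| ≤ C
  | n + 1, H => (∃ C : ℝ, ∀ z, |H z| ≤ C) ∧ Differentiable ℝ H ∧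
      HasBoundedPartials n (fun z => fderiv ℝ H z (1, 0)) ∧
      HasBoundedPartials n (fun z => fderiv ℝ H z (0, 1))

namespace HasBoundedPartials

variable {n : ℕ} {H : ℝ × ℝ → ℝ}

theorem bound (h : HasBoundedPartials n H) : ∃ C : ℝ, ∀ z, |H z| ≤ C := by
  cases n with
  | zero => exact h
  | succ n => exact h.1

theorem of_succ (h : HasBoundedPartials (n + 1) H) : HasBoundedPartials n H := by
  induction n generalizing H with
  | zero => exact h.1
  | succ n ih => exact ⟨h.1, h.2.1, ih h.2.2.1, ih h.2.2.2⟩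

theorem of_le {m : ℕ} (hmn : m ≤ n) (h : HasBoundedPartials n H) : HasBoundedPartials m H := by
  induction n, hmn using Nat.le_induction with
  | base => exact h
  | succ n _ ih => exact ih h.of_succ

theorem fderiv_swap {H : ℝ × ℝ → ℝ} (hH : ContDiff ℝ 2 H) (e₁ e₂ : ℝ × ℝ) (z : ℝ × ℝ) :
    fderiv ℝ (fun z => fderiv ℝ H z e₁) z e₂ = fderiv ℝ (fun z => fderiv ℝ H z e₂) z e₁ := by
  have hd : DifferentiableAt ℝ (fderiv ℝ H) z :=
    ((hH.fderiv_right (m := 1) (by norm_num)).differentiable (by norm_num)) z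
  have hs : IsSymmSndFDerivAt ℝ H z := hH.contDiffAt.isSymmSndFDerivAt (by simp)
  rw [fderiv_clm_apply hd (differentiableAt_const _), fderiv_clm_apply hd (differentiableAt_const _)]
  simpa using hs e₂ e₁

/-- Partial derivative in direction `e`, as an operator on functions. -/
noncomputable def partialD (e : ℝ × ℝ) (H : ℝ × ℝ → ℝ) : ℝ × ℝ → ℝ := fun z => fderiv ℝ H z e

theorem contDiff_partialD {e : ℝ × ℝ} (hH : ContDiff ℝ (n + 1 : ℕ) H) :
    ContDiff ℝ n (partialD e H) :=
  (hH.fderiv_right (m := n) (by norm_cast)).clm_apply contDiff_const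

theorem partialD_iterate_comm {e₁ e₂ : ℝ × ℝ} (hH : ContDiff ℝ (n + 1 : ℕ) H) :
    (partialD e₂)^[n] (partialD e₁ H) = partialD e₁ ((partialD e₂)^[n] H) := by
  induction n generalizing H with
  | zero => rfl
  | succ n ih =>
    rw [Function.iterate_succ_apply, Function.iterate_succ_apply, ← ih (contDiff_partialD hH)]
    congr 1
    funext z
    exact fderiv_swap (hH.of_le (by norm_cast; omega)) e₁ e₂ z

theorem of_contDiff (hH : ContDiff ℝ n H)
    (hb : ∀ i j, i + j ≤ n →
      ∃ C : ℝ, ∀ z, |((partialD (1, 0))^[i] ((partialD (0, 1))^[j] H)) z| ≤ C) :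
    HasBoundedPartials n H := by
  induction n generalizing H with
  | zero => exact hb 0 0 le_rfl
  | succ n ih =>
    refine ⟨hb 0 0 (Nat.zero_le _), hH.differentiable (by norm_cast),
      ih (contDiff_partialD hH) fun i j hij => ?_, ih (contDiff_partialD hH) fun i j hij => ?_⟩
    · have := hb (i + 1) j (by omega)
      rw [Function.iterate_succ_apply, ← partialD_iterate_comm (hH.of_le (by norm_cast; omega))]
        at this
      exact this
    · have := hb i (j + 1) (by omega)
      rwa [Function.iterate_succ_apply (partialD (0, 1))] at this

theorem iterate_partialD_eq {k : ℕ} (hH : ContDiff ℝ (n + k : ℕ) H) :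
    ContDiff ℝ k ((partialD (0, 1))^[n] H) ∧
    ∀ x t, ((partialD (0, 1))^[n] H) (x, t) = iteratedDeriv n (fun s => H (x, s)) t := by
  induction n generalizing H with
  | zero => exact ⟨by simpa using hH, fun x t => by simp⟩
  | succ n ih =>
    have h1 : ContDiff ℝ (n + k + 1 : ℕ) H := hH.of_le (by norm_cast; omega)
    obtain ⟨a, b⟩ := ih (contDiff_partialD (e := (0, 1)) h1)
    refine ⟨a, fun x t => ?_⟩
    rw [Function.iterate_succ_apply, b, iteratedDeriv_succ']
    congr 1
    funext s
    have hd : HasFDerivAt H (fderiv ℝ H (x, s)) (x, s) :=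
      ((h1.differentiable (by norm_cast)) _).hasFDerivAt
    have hc : HasDerivAt (fun s : ℝ => (x, s)) ((0 : ℝ), (1 : ℝ)) s :=
      (hasDerivAt_const s x).prodMk (hasDerivAt_id s)
    exact (hd.comp_hasDerivAt s hc).deriv.symm

theorem iterate_partialD_fst_eq (hH : ContDiff ℝ n H) (x t : ℝ) :
    ((partialD (1, 0))^[n] H) (x, t) = iteratedDeriv n (fun s => H (s, t)) x := by
  induction n generalizing H with
  | zero => simp
  | succ n ih =>
    rw [Function.iterate_succ_apply, ih (contDiff_partialD hH), iteratedDeriv_succ']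
    congr 1
    funext s
    have hd : HasFDerivAt H (fderiv ℝ H (s, t)) (s, t) :=
      ((hH.differentiable (by norm_cast)) _).hasFDerivAt
    have hc : HasDerivAt (fun s : ℝ => (s, t)) ((1 : ℝ), (0 : ℝ)) s :=
      (hasDerivAt_id s).prodMk (hasDerivAt_const s t)
    exact (hd.comp_hasDerivAt s hc).deriv.symm

theorem of_iterD_bounded {G : ℝ → ℝ → ℝ} {C : ℝ}
    (hG : ContDiff ℝ n (fun z : ℝ × ℝ => G z.1 z.2))
    (hb : ∀ i j : ℕ, i + j ≤ n → ∀ x t : ℝ, |iterD G i j x t| ≤ C) :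
    HasBoundedPartials n (fun z : ℝ × ℝ => G z.1 z.2) := by
  refine of_contDiff hG fun i j hij => ⟨C, fun ⟨x, t⟩ => ?_⟩
  have h1 := iterate_partialD_eq (n := j) (k := i)
    (hG.of_le (by norm_cast; omega) : ContDiff ℝ (j + i : ℕ) (fun z : ℝ × ℝ => G z.1 z.2))
  rw [iterate_partialD_fst_eq h1.1]
  simp only [h1.2]
  exact hb i j hij x t

end HasBoundedPartials

namespace IsSymbol

variable {h₀ δ : ℝ} {n : ℕ} {y yh yt : ℝ → ℝ → ℝ → ℝ}

theorem rpow {p c₁ c₂ : ℝ} (h1 : 1 ≤ h₀) (hp : 0 < p) (hc₁ : 0 < c₁)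
    (hlo : ∀ θ h t, h₀ < h → c₁ * h ^ (1 / p) ≤ y θ h t)
    (hhi : ∀ θ h t, h₀ < h → y θ h t ≤ c₂ * h ^ (1 / p))
    (hyh : ∀ θ h t, h₀ < h → HasDerivAt (fun s => y θ s t) (yh θ h t) h)
    (hyt : ∀ θ h t, h₀ < h → HasDerivAt (fun s => y θ h s) (yt θ h t) t)
    (hh : ∀ k < n, IsSymbol h₀ k (affineWeight δ (-δ)) yh)
    (ht : ∀ k < n, IsSymbol h₀ k (affineWeight δ 0) yt) (s : ℝ) :
    IsSymbol h₀ n (affineWeight δ (s / p)) (fun θ h t => y θ h t ^ s) := by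
  have hy0 : ∀ θ h t, h₀ < h → 0 < y θ h t := fun θ h t hh =>
    (mul_pos hc₁ (Real.rpow_pos_of_pos (by linarith) _)).trans_le (hlo θ h t hh)
  have hb : ∀ s : ℝ, ∃ C : ℝ, ∀ θ h t, h₀ < h →
      |y θ h t ^ s| ≤ C * h ^ affineWeight δ (s / p) 0 := by
    intro s
    have key : ∀ h, h₀ < h → ∀ c, 0 ≤ c → (c * h ^ (1 / p)) ^ s = c ^ s * h ^ (s / p) := by
      intro h hh c hc
      have hh0 : 0 ≤ h := by linarith
      rw [Real.mul_rpow hc (Real.rpow_nonneg hh0 _), ← Real.rpow_mul hh0]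
      congr 2
      ring
    rw [affineWeight_zero]
    rcases le_or_gt 0 s with hs | hs
    · refine ⟨|c₂| ^ s, fun θ h t hh => ?_⟩
      have h0 : 0 < y θ h t := hy0 θ h t hh
      rw [abs_of_nonneg (Real.rpow_nonneg h0.le _), ← key h hh _ (abs_nonneg _)]
      refine Real.rpow_le_rpow h0.le ((hhi θ h t hh).trans ?_) hs
      have : 0 ≤ h ^ (1 / p) := Real.rpow_nonneg (by linarith) _
      gcongr
      exact le_abs_self _
    · refine ⟨c₁ ^ s, fun θ h t hh => ?_⟩
      have h0 : 0 < y θ h t := hy0 θ h t hh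
      rw [abs_of_nonneg (Real.rpow_nonneg h0.le _), ← key h hh _ hc₁.le]
      have : 0 < h ^ (1 / p) := Real.rpow_pos_of_pos (by linarith) _
      exact Real.rpow_le_rpow_of_nonpos (by positivity) (hlo θ h t hh) hs.le
  induction n generalizing s with
  | zero => exact hb s
  | succ n ih =>
    have i1 : IsSymbol h₀ n (affineWeight δ (s / p)) (fun θ h t => s * y θ h t ^ (s - 1)) := by
      refine const_mul h1 (v := fun _ => s) (fun _ => le_rfl) (mono_affine h1 ?_
        (ih (fun k hk => hh k (by omega)) (fun k hk => ht k (by omega)) (s - 1)))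
      gcongr
      linarith
    refine ⟨hb s, fun θ h t => s * y θ h t ^ (s - 1) * yh θ h t,
      fun θ h t => s * y θ h t ^ (s - 1) * yt θ h t, fun θ h t hh => ?_, fun θ h t hh => ?_, ?_, ?_⟩
    · convert (hyh θ h t hh).rpow_const (p := s) (Or.inl (hy0 θ h t hh).ne') using 1
      ring
    · convert (hyt θ h t hh).rpow_const (p := s) (Or.inl (hy0 θ h t hh).ne') using 1
      ring
    · rw [affineWeight_succ]
      exact i1.mul_affine h1 (by linarith) (hh n (by omega))
    · exact i1.mul_affine h1 (by linarith) (ht n (by omega))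

theorem comp {H : ℝ × ℝ → ℝ} {v : ℝ → ℝ} {A V : ℝ} (h1 : 1 ≤ h₀) (hv : ∀ θ, |v θ| ≤ V)
    (hyh : ∀ θ h t, h₀ < h → HasDerivAt (fun s => y θ s t) (yh θ h t) h)
    (hyt : ∀ θ h t, h₀ < h → HasDerivAt (fun s => y θ h s) (yt θ h t) t)
    (hh : ∀ k < n, IsSymbol h₀ k (affineWeight δ (-δ)) yh)
    (ht : ∀ k < n, IsSymbol h₀ k (affineWeight δ 0) yt) (hH : HasBoundedPartials n H) :
    IsSymbol h₀ n (affineWeight δ 0) (fun θ h t => H (A * y θ h t * v θ, t)) := by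
  induction n generalizing H with
  | zero =>
    obtain ⟨C, hC⟩ := hH
    exact ⟨C, fun θ h t _ => by simpa [affineWeight_zero] using hC _⟩
  | succ n ih =>
    have ih' := fun {H} => ih (H := H) (fun k hk => hh k (by omega)) (fun k hk => ht k (by omega))
    obtain ⟨⟨C, hC⟩, hd, hx, hs⟩ := hH
    have hAv : ∀ θ, |A * v θ| ≤ |A| * V := fun θ => by
      rw [abs_mul]
      exact mul_le_mul_of_nonneg_left (hv θ) (abs_nonneg _)
    have key : ∀ (z : ℝ × ℝ) (a b : ℝ), fderiv ℝ H z (a, b) =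
        fderiv ℝ H z (1, 0) * a + fderiv ℝ H z (0, 1) * b := fun z a b => by
      have : ((a, b) : ℝ × ℝ) = a • (1, 0) + b • (0, 1) := by simp
      rw [this, map_add, map_smul, map_smul, smul_eq_mul, smul_eq_mul]
      ring
    refine ⟨⟨C, fun θ h t _ => by simpa [affineWeight_zero] using hC _⟩,
      fun θ h t => fderiv ℝ H (A * y θ h t * v θ, t) (1, 0) * (A * v θ * yh θ h t),
      fun θ h t => fderiv ℝ H (A * y θ h t * v θ, t) (1, 0) * (A * v θ * yt θ h t) +
        fderiv ℝ H (A * y θ h t * v θ, t) (0, 1), fun θ h t hh => ?_, fun θ h t hh => ?_, ?_, ?_⟩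
    · have h2 := (hd (A * y θ h t * v θ, t)).hasFDerivAt.comp_hasDerivAt h
        ((((hyh θ h t hh).const_mul A).mul_const (v θ)).prodMk (hasDerivAt_const h t))
      refine h2.congr_deriv ?_
      rw [key]
      ring
    · have h2 := (hd (A * y θ h t * v θ, t)).hasFDerivAt.comp_hasDerivAt
        (f := fun s => (A * y θ h s * v θ, s)) t
        ((((hyt θ h t hh).const_mul A).mul_const (v θ)).prodMk (hasDerivAt_id t))
      refine h2.congr_deriv ?_
      rw [key]
      ring
    · rw [affineWeight_succ]
      exact (ih' hx).mul_affine h1 (by linarith) (const_mul h1 hAv (hh n (by omega)))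
    · exact ((ih' hx).mul_affine h1 (by linarith) (const_mul h1 hAv (ht n (by omega)))).add (ih' hs)

end IsSymbol

/-- A solution branch `y` of `F (y s, s) = 0` along which `F`
is expanding in its first variable is differentiable. -/
theorem hasDerivAt_of_implicit {F : ℝ × ℝ → ℝ} {L : ℝ × ℝ →L[ℝ] ℝ} {y : ℝ → ℝ} {s₀ : ℝ}
    (hF : HasFDerivAt F L (y s₀, s₀)) (hL : L (1, 0) ≠ 0) (hz : ∀ᶠ s in nhds s₀, F (y s, s) = 0)
    (hm : ∀ᶠ s in nhds s₀, |y s - y s₀| ≤ |F (y s, s) - F (y s₀, s)|) :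
    HasDerivAt y (-L (0, 1) / L (1, 0)) s₀ := by
  have hc : HasDerivAt (fun s : ℝ => (y s₀, s)) ((0 : ℝ), (1 : ℝ)) s₀ :=
    (hasDerivAt_const s₀ (y s₀)).prodMk (hasDerivAt_id s₀)
  have hz0 : F (y s₀, s₀) = 0 := hz.self_of_nhds
  have hO : (fun s => y s - y s₀) =O[nhds s₀] fun s => s - s₀ := by
    have h1 : (fun s => F (y s₀, s) - F (y s₀, s₀)) =O[nhds s₀] fun s => s - s₀ :=
      (hF.comp_hasDerivAt s₀ hc).isBigO_sub
    refine Asymptotics.IsBigO.trans (Asymptotics.IsBigO.of_bound 1 ?_) h1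
    filter_upwards [hz, hm] with s a b
    rw [a, zero_sub, abs_neg] at b
    rw [hz0, sub_zero, one_mul]
    exact b
  have hcont : Filter.Tendsto (fun s => (y s, s)) (nhds s₀) (nhds (y s₀, s₀)) := by
    refine Filter.Tendsto.prodMk_nhds ?_ Filter.tendsto_id
    have : Filter.Tendsto (fun s => s - s₀) (nhds s₀) (nhds 0) := by
      have : Filter.Tendsto (fun s => s - s₀) (nhds s₀) (nhds (s₀ - s₀)) :=
        Filter.tendsto_id.sub_const _
      simpa using this
    exact tendsto_sub_nhds_zero_iff.1 (hO.trans_tendsto this)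
  have ho := hF.isLittleO.comp_tendsto hcont
  have hO2 : (fun s => (y s, s) - (y s₀, s₀)) =O[nhds s₀] fun s => s - s₀ :=
    hO.prod_left (Asymptotics.isBigO_refl _ _)
  have ho2 := ho.trans_isBigO hO2
  rw [hasDerivAt_iff_isLittleO]
  refine (ho2.const_mul_left (-(L (1, 0))⁻¹)).congr' ?_ Filter.EventuallyEq.rfl
  filter_upwards [hz] with s hs
  have e : L ((y s, s) - (y s₀, s₀)) = L (1, 0) * (y s - y s₀) + L (0, 1) * (s - s₀) := by
    have : ((y s, s) - (y s₀, s₀) : ℝ × ℝ) = (y s - y s₀) • (1, 0) + (s - s₀) • (0, 1) := by simp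
    rw [this, map_add, map_smul, map_smul, smul_eq_mul, smul_eq_mul]
    ring
  simp only [Function.comp, hs, hz0, e, smul_eq_mul]
  field_simp
  ring

theorem exists_bound_of_periodic {g : ℝ → ℝ} {c : ℝ} (hc : 0 < c) (hg : Function.Periodic g c)
    (hcont : Continuous g) : ∃ C, ∀ t, |g t| ≤ C := by
  obtain ⟨C, hC⟩ := (isCompact_Icc (a := (0 : ℝ)) (b := c)).exists_bound_of_continuousOn
    hcont.continuousOn
  refine ⟨C, fun t => ?_⟩
  obtain ⟨s, hs, he⟩ := hg.exists_mem_Ico₀ hc t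
  rw [he]
  exact hC s ⟨hs.1, hs.2.le⟩

theorem periodic_iteratedDeriv {g : ℝ → ℝ} {c : ℝ} (hg : Function.Periodic g c) (k : ℕ) :
    Function.Periodic (iteratedDeriv k g) c := by
  intro t
  have : (fun s => g (s + c)) = g := funext hg
  rw [← congrFun (iteratedDeriv_comp_add_const k g c) t, this]

theorem phi_max_eq {p : ℝ} (hp : 2 ≤ p) (x : ℝ) : phi p (max x 0) = (max x 0) ^ (p - 1) := by
  unfold phi
  rcases le_or_gt x 0 with h | h
  · rw [max_eq_right h, mul_zero, Real.zero_rpow (by linarith)]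
  · rw [max_eq_left h.le, abs_of_pos h, ← Real.rpow_add_one h.ne']
    congr 1
    ring

theorem hasDerivAt_max_rpow {p : ℝ} (hp : 2 ≤ p) (x : ℝ) :
    HasDerivAt (fun x => (max x 0) ^ p) (p * phi p (max x 0)) x := by
  rw [phi_max_eq hp]
  rcases lt_trichotomy x 0 with h | rfl | h
  · rw [max_eq_right h.le, Real.zero_rpow (by linarith), mul_zero]
    refine (hasDerivAt_const x (0 : ℝ)).congr_of_eventuallyEq ?_
    filter_upwards [gt_mem_nhds h] with s hs
    rw [max_eq_right hs.le, Real.zero_rpow (by linarith)]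
  · rw [max_self, Real.zero_rpow (by linarith), mul_zero]
    have h1 := (hasDerivAt_abs_rpow (0 : ℝ) (show 1 < p by linarith))
    rw [hasDerivAt_iff_isLittleO] at h1 ⊢
    refine (Asymptotics.IsBigO.of_bound 1 (Filter.Eventually.of_forall fun s => ?_)).trans_isLittleO
      h1
    have e0 : (0 : ℝ) ^ p = 0 := Real.zero_rpow (by linarith)
    simp only [max_self, e0, abs_zero, mul_zero, smul_zero, sub_zero, one_mul, Real.norm_eq_abs]
    rw [abs_of_nonneg (Real.rpow_nonneg (le_max_right _ _) _),
      abs_of_nonneg (Real.rpow_nonneg (abs_nonneg _) _)]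
    exact Real.rpow_le_rpow (le_max_right _ _) (max_le (le_abs_self s) (abs_nonneg s)) (by linarith)
  · rw [max_eq_left h.le]
    refine (Real.hasDerivAt_rpow_const (Or.inl h.ne')).congr_of_eventuallyEq ?_
    filter_upwards [lt_mem_nhds h] with s hs
    rw [max_eq_left hs.le]

theorem phi_conj_phi {p q : ℝ} (hp : 2 ≤ p) (hq : q = p / (p - 1)) (s : ℝ) :
    |phi p s| ^ (q - 2) * phi p s = s := by
  unfold phi
  rcases eq_or_ne s 0 with rfl | hs
  · simp
  · have h0 : 0 < |s| := abs_pos.2 hs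
    rw [abs_mul, abs_of_nonneg (Real.rpow_nonneg h0.le _), ← Real.rpow_add_one h0.ne',
      ← Real.rpow_mul h0.le, ← mul_assoc, ← Real.rpow_add h0]
    have : (p - 2 + 1) * (q - 2) + (p - 2) = 0 := by
      have : p - 1 ≠ 0 := by linarith
      rw [hq]
      field_simp
      ring
    rw [this, Real.rpow_zero, one_mul]

/-- Conservation of energy bounds the solutions of the asymmetric oscillator. -/
theorem exists_bound_of_oscillator {p q a b : ℝ} {v v' : ℝ → ℝ} (hp : 2 ≤ p) (hq : q = p / (p - 1))
    (ha : 0 < a) (hb : 0 < b) (hv : ∀ t, HasDerivAt v (v' t) t)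
    (hode : ∀ t, HasDerivAt (fun s => phi p (v' s))
      (-a * phi p (max (v t) 0) + b * phi p (max (-v t) 0)) t) :
    ∃ V, ∀ t, |v t| ≤ V := by
  have hp1 : 0 < p - 1 := by linarith
  have hq1 : 1 < q := by rw [hq, lt_div_iff₀ hp1]; linarith
  set E : ℝ → ℝ := fun t => p * |phi p (v' t)| ^ q +
    q * (a * (max (v t) 0) ^ p + b * (max (-v t) 0) ^ p) with hE
  have hE' : ∀ t, HasDerivAt E 0 t := by
    intro t
    have h1 := ((hasDerivAt_abs_rpow (phi p (v' t)) hq1).comp t (hode t)).const_mul p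
    have h2 := ((hasDerivAt_max_rpow hp (v t)).comp t (hv t)).const_mul a
    have h3 := ((hasDerivAt_max_rpow hp (-v t)).comp t (hv t).neg).const_mul b
    refine (h1.add ((h2.add h3).const_mul q)).congr_deriv ?_
    rw [mul_assoc q, phi_conj_phi hp hq]
    ring
  have hconst : ∀ t, E t = E 0 := fun t =>
    is_const_of_deriv_eq_zero (fun s => (hE' s).differentiableAt) (fun s => (hE' s).deriv) t 0
  have key : ∀ x : ℝ, 0 ≤ x → ∀ c, 0 < c → q * (c * x ^ p) ≤ E 0 → x ≤ max 1 (E 0 / (q * c)) := by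
    intro x hx c hc h
    rcases le_or_gt x 1 with h1 | h1
    · exact le_max_of_le_left h1
    · refine le_max_of_le_right ?_
      rw [le_div_iff₀ (by positivity)]
      have : x ≤ x ^ p := Real.self_le_rpow_of_one_le h1.le (by linarith)
      have : q * c * x ≤ q * c * x ^ p := by gcongr
      linarith
  refine ⟨max (max 1 (E 0 / (q * a))) (max 1 (E 0 / (q * b))), fun t => ?_⟩
  have ht := hconst t
  have e1 : 0 ≤ p * |phi p (v' t)| ^ q := by positivity
  have n1 : 0 ≤ max (v t) 0 := le_max_right _ _
  have n2 : 0 ≤ max (-v t) 0 := le_max_right _ _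
  have e2 : 0 ≤ q * (a * (max (v t) 0) ^ p) := by positivity
  have e3 : 0 ≤ q * (b * (max (-v t) 0) ^ p) := by positivity
  have ht' : p * |phi p (v' t)| ^ q +
    q * (a * (max (v t) 0) ^ p + b * (max (-v t) 0) ^ p) = E 0 := ht
  refine abs_le'.2 ⟨?_, ?_⟩
  · exact le_max_of_le_left ((le_max_left _ _).trans (key _ n1 a ha (by linarith)))
  · exact le_max_of_le_right ((le_max_left _ _).trans (key _ n2 b hb (by linarith)))

/-- The derivative in its first argument of the function defining `y` dominates `x ^ (p - 1)`. -/
theorem rpow_le_profile_deriv {p M x a : ℝ} (hp : 2 ≤ p) (hx : 1 ≤ x) (hxM : M ≤ x)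
    (ha : |a| ≤ M) : x ^ (p - 1) ≤ p * x ^ (p - 1) + a := by
  have h1 : x ≤ x ^ (p - 1) := Real.self_le_rpow_of_one_le hx (by linarith)
  have h2 : 2 * x ^ (p - 1) ≤ p * x ^ (p - 1) := by gcongr
  have := (abs_le.1 ha).1
  linarith

/-- Differentiability of a large solution `y` of
`y ^ p + (W G(A y c, g) - W A y c f(g)) = ω k` with respect to a parameter. -/
theorem hasDerivAt_profile {p ω A W c M Y g' k' s₀ : ℝ} {G : ℝ × ℝ → ℝ} {f g k y : ℝ → ℝ}
    (hp : 2 ≤ p) (hG : Differentiable ℝ G) (hf : Differentiable ℝ f)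
    (hg : HasDerivAt g g' s₀) (hk : HasDerivAt k k' s₀) (hY : 1 ≤ Y) (hMY : M ≤ Y)
    (hM : ∀ x t, |W * A * c * fderiv ℝ G (x, t) (1, 0) - W * A * (c * f t)| ≤ M)
    (hy : ∀ᶠ s in nhds s₀, Y ≤ y s)
    (hz : ∀ᶠ s in nhds s₀,
      y s ^ p + (W * G (A * y s * c, g s) - W * A * (y s * (c * f (g s)))) = ω * k s) :
    HasDerivAt y ((ω * k' - (W * fderiv ℝ G (A * y s₀ * c, g s₀) (0, 1) -
        W * A * (y s₀ * (c * deriv f (g s₀)))) * g') *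
      (p * y s₀ ^ (p - 1) + (W * A * c * fderiv ℝ G (A * y s₀ * c, g s₀) (1, 0) -
        W * A * (c * f (g s₀))))⁻¹) s₀ := by
  set F : ℝ × ℝ → ℝ := fun z =>
    z.1 ^ p + (W * G (A * z.1 * c, g z.2) - W * A * (z.1 * (c * f (g z.2)))) - ω * k z.2 with hF
  have hy0 : Y ≤ y s₀ := hy.self_of_nhds
  have hdG : ∀ (z : ℝ × ℝ) (a b : ℝ), fderiv ℝ G z (a, b) =
      fderiv ℝ G z (1, 0) * a + fderiv ℝ G z (0, 1) * b := fun z a b => by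
    have : ((a, b) : ℝ × ℝ) = a • (1, 0) + b • (0, 1) := by simp
    rw [this, map_add, map_smul, map_smul, smul_eq_mul, smul_eq_mul]
    ring
  have hdiff : DifferentiableAt ℝ F (y s₀, s₀) := by
    have hg2 : DifferentiableAt ℝ (fun z : ℝ × ℝ => g z.2) (y s₀, s₀) :=
      DifferentiableAt.comp (y s₀, s₀) (g := g) hg.differentiableAt differentiableAt_snd
    have hk2 : DifferentiableAt ℝ (fun z : ℝ × ℝ => k z.2) (y s₀, s₀) :=
      DifferentiableAt.comp (y s₀, s₀) (g := k) hk.differentiableAt differentiableAt_snd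
    have hf2 : DifferentiableAt ℝ (fun z : ℝ × ℝ => f (g z.2)) (y s₀, s₀) :=
      DifferentiableAt.comp (y s₀, s₀) (g := f) (hf _) hg2
    have hG2 : DifferentiableAt ℝ (fun z : ℝ × ℝ => G (A * z.1 * c, g z.2)) (y s₀, s₀) :=
      DifferentiableAt.comp (y s₀, s₀) (g := G) (hG _)
        (((differentiableAt_fst.const_mul A).mul_const c).prodMk hg2)
    have hp2 : DifferentiableAt ℝ (fun z : ℝ × ℝ => z.1 ^ p) (y s₀, s₀) :=
      differentiableAt_fst.rpow_const (Or.inr (by linarith))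
    exact (hp2.add ((hG2.const_mul W).sub
      ((differentiableAt_fst.mul (hf2.const_mul c)).const_mul (W * A)))).sub (hk2.const_mul ω)
  have hx : ∀ x s, HasDerivAt (fun x => F (x, s)) (p * x ^ (p - 1) +
      (W * A * c * fderiv ℝ G (A * x * c, g s) (1, 0) - W * A * (c * f (g s)))) x := by
    intro x s
    have h1 : HasDerivAt (fun x : ℝ => x ^ p) (p * x ^ (p - 1)) x :=
      Real.hasDerivAt_rpow_const (Or.inr (by linarith))
    have h2 := (hG (A * x * c, g s)).hasFDerivAt.comp_hasDerivAt x
      ((((hasDerivAt_id' x).const_mul A).mul_const c).prodMk (hasDerivAt_const x (g s)))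
    refine ((h1.add ((h2.const_mul W).sub
      (((hasDerivAt_id' x).mul_const (c * f (g s))).const_mul (W * A)))).sub_const
        (ω * k s)).congr_deriv ?_
    rw [hdG]
    ring
  have hs : HasDerivAt (fun s => F (y s₀, s))
      ((W * fderiv ℝ G (A * y s₀ * c, g s₀) (0, 1) -
        W * A * (y s₀ * (c * deriv f (g s₀)))) * g' - ω * k') s₀ := by
    have h2 := (hG (A * y s₀ * c, g s₀)).hasFDerivAt.comp_hasDerivAt
      (f := fun s => (A * y s₀ * c, g s)) s₀ ((hasDerivAt_const s₀ (A * y s₀ * c)).prodMk hg)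
    have h3 : HasDerivAt (fun s => f (g s)) (deriv f (g s₀) * g') s₀ :=
      (hf (g s₀)).hasDerivAt.comp s₀ hg
    refine ((((h2.const_mul W).sub (((h3.const_mul c).const_mul (y s₀)).const_mul (W * A))).const_add
      (y s₀ ^ p)).sub (hk.const_mul ω)).congr_deriv ?_
    rw [hdG]
    ring
  have L1 : fderiv ℝ F (y s₀, s₀) (1, 0) = p * y s₀ ^ (p - 1) +
      (W * A * c * fderiv ℝ G (A * y s₀ * c, g s₀) (1, 0) - W * A * (c * f (g s₀))) :=
    (hdiff.hasFDerivAt.comp_hasDerivAt (f := fun x => (x, s₀)) (y s₀)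
      ((hasDerivAt_id' (y s₀)).prodMk (hasDerivAt_const _ s₀))).unique (hx _ _)
  have L2 := (hdiff.hasFDerivAt.comp_hasDerivAt (f := fun s => (y s₀, s)) s₀
      ((hasDerivAt_const s₀ (y s₀)).prodMk (hasDerivAt_id' s₀))).unique hs
  have hone : ∀ x, Y ≤ x → ∀ s, 1 ≤ p * x ^ (p - 1) +
      (W * A * c * fderiv ℝ G (A * x * c, g s) (1, 0) - W * A * (c * f (g s))) := fun x hxY s =>
    (Real.one_le_rpow (hY.trans hxY) (by linarith)).trans
      (rpow_le_profile_deriv hp (hY.trans hxY) (hMY.trans hxY) (hM _ _))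
  have hexp : ∀ s, ∀ x₁ x₂, Y ≤ x₁ → x₁ ≤ x₂ → x₂ - x₁ ≤ F (x₂, s) - F (x₁, s) := by
    intro s x₁ x₂ h1 h2
    have := (convex_Ici Y).mul_sub_le_image_sub_of_le_deriv (f := fun x => F (x, s)) (C := 1)
      (fun x _ => (hx x s).continuousAt.continuousWithinAt)
      (fun x _ => (hx x s).differentiableAt.differentiableWithinAt)
      (fun x hx' => by
        rw [(hx x s).deriv]
        exact hone x (interior_subset hx') s) x₁ h1 x₂ (h1.trans h2) h2
    linarith
  have hne := (zero_lt_one.trans_le (hone _ hy0 s₀)).ne'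
  refine (hasDerivAt_of_implicit (F := F) hdiff.hasFDerivAt (by rw [L1]; exact hne) ?_ ?_).congr_deriv
    ?_
  · filter_upwards [hz] with s hs
    simp only [hF]
    linarith
  · filter_upwards [hy] with s hs
    rcases le_total (y s₀) (y s) with h | h
    · rw [abs_of_nonneg (sub_nonneg.2 h)]
      exact (hexp s _ _ hy0 h).trans (le_abs_self _)
    · rw [abs_sub_comm, abs_sub_comm (F _), abs_of_nonneg (sub_nonneg.2 h)]
      exact (hexp s _ _ hs h).trans (le_abs_self _)
  · rw [L1, L2, div_eq_mul_inv]
    ring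

/-- Symbol estimates for the perturbation term along a large solution `y` of
`y ^ p + (W G(A y v, t) - W A y v f) = ω h`. -/
theorem isSymbol_of_implicit {p q ω A W V M Y c₁ c₂ h₀ : ℝ} {n : ℕ} {G : ℝ × ℝ → ℝ} {f v : ℝ → ℝ}
    {y : ℝ → ℝ → ℝ → ℝ} (hp : 2 ≤ p) (hq : q = p / (p - 1))
    (hG : HasBoundedPartials (n + 1) G) (hf : ContDiff ℝ (n + 1 : ℕ) f)
    (hfb : ∀ k ≤ n + 1, ∃ C, ∀ t, |iteratedDeriv k f t| ≤ C)
    (hv : ∀ θ, |v θ| ≤ V) (hY : 1 ≤ Y) (hMY : M ≤ Y) (h1 : 1 ≤ h₀) (hc₁ : 0 < c₁)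
    (hM : ∀ θ x t, |W * A * v θ * fderiv ℝ G (x, t) (1, 0) - W * A * (v θ * f t)| ≤ M)
    (hyY : ∀ θ h t, h₀ < h → Y ≤ y θ h t)
    (hlo : ∀ θ h t, h₀ < h → c₁ * h ^ (1 / p) ≤ y θ h t)
    (hhi : ∀ θ h t, h₀ < h → y θ h t ≤ c₂ * h ^ (1 / p))
    (heq : ∀ θ h t, h₀ < h → y θ h t ^ p +
      (W * G (A * y θ h t * v θ, t) - W * A * (y θ h t * (v θ * f t))) = ω * h) :
    IsSymbol h₀ (n + 1) (nExp p q)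
      (fun θ h t => W * G (A * y θ h t * v θ, t) - W * A * (y θ h t * (v θ * f t))) := by
  obtain ⟨-, hGd, hGx, hGt⟩ := id hG
  have hfd : Differentiable ℝ f := hf.differentiable (by norm_cast)
  have hp0 : 0 < p := by linarith
  set δ : ℝ := (p - 1) / p with hδ
  have hδ0 : 0 ≤ δ := div_nonneg (by linarith) hp0.le
  have hpδ : 1 / p ≤ δ := by rw [hδ]; gcongr; linarith
  have hqδ : ∀ x : ℝ, x / q = x * δ := fun x => by
    rw [hq, hδ, div_div_eq_mul_div, mul_div_assoc]
  set D : ℝ → ℝ → ℝ → ℝ := fun θ h t => p * y θ h t ^ (p - 1) +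
    (W * A * v θ * fderiv ℝ G (A * y θ h t * v θ, t) (1, 0) - W * A * (v θ * f t)) with hD
  set yh : ℝ → ℝ → ℝ → ℝ := fun θ h t => ω * (D θ h t)⁻¹ with hyh_def
  set yt : ℝ → ℝ → ℝ → ℝ := fun θ h t =>
    (-W * fderiv ℝ G (A * y θ h t * v θ, t) (0, 1) + W * A * (y θ h t * (v θ * deriv f t))) *
      (D θ h t)⁻¹ with hyt_def
  have hyh : ∀ θ h t, h₀ < h → HasDerivAt (fun s => y θ s t) (yh θ h t) h := by
    intro θ h t hh
    refine (hasDerivAt_profile (ω := ω) (g := fun _ => t) (k := fun s => s) hp hGd hfd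
      (hasDerivAt_const h t) (hasDerivAt_id' h) hY hMY (hM θ) ?_ ?_).congr_deriv ?_
    · filter_upwards [lt_mem_nhds hh] with s hs using hyY θ s t hs
    · filter_upwards [lt_mem_nhds hh] with s hs using heq θ s t hs
    · simp only [hyh_def, hD]
      ring
  have hyt : ∀ θ h t, h₀ < h → HasDerivAt (fun s => y θ h s) (yt θ h t) t := by
    intro θ h t hh
    refine (hasDerivAt_profile (ω := ω) (g := fun s => s) (k := fun _ => h) hp hGd hfd
      (hasDerivAt_id' t) (hasDerivAt_const t h) hY hMY (hM θ) ?_ ?_).congr_deriv ?_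
    · exact Filter.Eventually.of_forall fun s => hyY θ h s hh
    · exact Filter.Eventually.of_forall fun s => heq θ h s hh
    · simp only [hyt_def, hD]
      ring
  have hDlo : ∀ θ h t, h₀ < h → c₁ ^ (p - 1) * h ^ δ ≤ D θ h t := by
    intro θ h t hh
    have hh0 : 0 ≤ h := by linarith
    have hyY' := hyY θ h t hh
    refine le_trans ?_ (rpow_le_profile_deriv hp (hY.trans hyY') (hMY.trans hyY') (hM θ _ t))
    have e : c₁ ^ (p - 1) * h ^ δ = (c₁ * h ^ (1 / p)) ^ (p - 1) := by
      rw [Real.mul_rpow hc₁.le (Real.rpow_nonneg hh0 _), ← Real.rpow_mul hh0]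
      congr 2
      rw [hδ]
      ring
    rw [e]
    exact Real.rpow_le_rpow (mul_nonneg hc₁.le (Real.rpow_nonneg hh0 _)) (hlo θ h t hh)
      (by linarith)
  have hWAv : ∀ θ, |W * A * v θ| ≤ |W * A| * V := fun θ => by
    rw [abs_mul]
    exact mul_le_mul_of_nonneg_left (hv θ) (abs_nonneg _)
  have hf' : ContDiff ℝ n (deriv f) := by
    rw [Nat.cast_succ, contDiff_succ_iff_deriv] at hf
    exact hf.2.2
  have key : ∀ m ≤ n, IsSymbol h₀ m (affineWeight δ (-δ)) yh ∧
      IsSymbol h₀ m (affineWeight δ 0) yt := by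
    intro m
    induction m using Nat.strong_induction_on with
    | _ m ih =>
    intro hm
    have ih1 : ∀ k < m, IsSymbol h₀ k (affineWeight δ (-δ)) yh :=
      fun k hk => (ih k hk (by omega)).1
    have ih2 : ∀ k < m, IsSymbol h₀ k (affineWeight δ 0) yt :=
      fun k hk => (ih k hk (by omega)).2
    have hpow := IsSymbol.rpow h1 hp0 hc₁ hlo hhi hyh hyt ih1 ih2
    have sy : IsSymbol h₀ m (affineWeight δ (1 / p)) y :=
      (hpow 1).congr fun θ h t _ => (Real.rpow_one _).symm
    have sx := IsSymbol.comp (A := A) h1 hv hyh hyt ih1 ih2 (hGx.of_le hm)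
    have st := IsSymbol.comp (A := A) h1 hv hyh hyt ih1 ih2 (hGt.of_le hm)
    have sf : IsSymbol h₀ m (affineWeight δ 0) (fun θ _ t => v θ * f t) :=
      IsSymbol.of_iteratedDeriv_bounded h1 (affineWeight_zero δ 0).ge hv
        (hf.of_le (by norm_cast; omega)) fun k hk => hfb k (by omega)
    have sf' : IsSymbol h₀ m (affineWeight δ 0) (fun θ _ t => v θ * deriv f t) :=
      IsSymbol.of_iteratedDeriv_bounded h1 (affineWeight_zero δ 0).ge hv
        (hf'.of_le (by norm_cast)) fun k hk => by
          have := hfb (k + 1) (by omega)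
          rwa [iteratedDeriv_succ'] at this
    have sD : IsSymbol h₀ m (affineWeight δ δ) D := by
      refine ((IsSymbol.const_mul h1 (v := fun _ => p) (fun _ => le_rfl) (hpow (p - 1))).add
        (((IsSymbol.const_mul h1 hWAv sx).add
          (IsSymbol.const_mul h1 (v := fun _ => -(W * A)) (fun _ => le_rfl) sf)).mono_affine h1
            hδ0)).congr fun θ h t _ => ?_
      simp only [hD]
      ring
    have sI := sD.inv h1 (Real.rpow_pos_of_pos hc₁ (p - 1)) hDlo
    refine ⟨IsSymbol.const_mul h1 (v := fun _ => ω) (fun _ => le_rfl) sI, ?_⟩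
    have s1 := (IsSymbol.const_mul h1 (v := fun _ => -W) (fun _ => le_rfl) st).mono_affine h1
      (show (0 : ℝ) ≤ 1 / p by positivity)
    have s2 := IsSymbol.const_mul h1 (v := fun _ => W * A) (fun _ => le_rfl)
      (sy.mul_affine h1 (add_zero (1 / p)).le sf')
    exact (s1.add s2).mul_affine h1 (by linarith) sI
  have hle : ∀ i, affineWeight δ 0 i ≤ nExp p q i := fun i => by
    unfold affineWeight nExp
    split_ifs with h
    · subst h
      simpa using hp0.le
    · rw [hqδ]
      linarith
  have sy : IsSymbol h₀ (n + 1) (nExp p q) y := by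
    refine ⟨⟨c₂, fun θ h t hh => ?_⟩, yh, yt, hyh, hyt, (key n le_rfl).1.mono h1 fun i => ?_,
      (key n le_rfl).2.mono h1 hle⟩
    · rw [abs_of_nonneg (zero_le_one.trans (hY.trans (hyY θ h t hh)))]
      simpa [nExp] using hhi θ h t hh
    · have := hle (i + 1)
      unfold affineWeight at this ⊢
      push_cast at this
      linarith
  have sG := (IsSymbol.const_mul h1 (v := fun _ => W) (fun _ => le_rfl)
    (IsSymbol.comp (A := A) h1 hv hyh hyt (fun k hk => (key k (by omega)).1)
      (fun k hk => (key k (by omega)).2) hG)).mono h1 hle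
  have sf : IsSymbol h₀ (n + 1) (fun i => if i = 0 then 0 else -(i : ℝ) / q - 1 / p)
      (fun θ _ t => -(W * A) * v θ * f t) :=
    IsSymbol.of_iteratedDeriv_bounded h1 (by simp) (V := |W * A| * V)
      (fun θ => by simpa [abs_mul] using hWAv θ) hf hfb
  refine (sG.add (sy.mul h1 (fun i j => ?_) sf)).congr fun θ h t _ => by ring
  have hp1 : 0 ≤ 1 / p := by positivity
  simp only [nExp]
  rcases Nat.eq_zero_or_pos i with rfl | hi <;> rcases Nat.eq_zero_or_pos j with rfl | hj
  · simp
  · simp [hj.ne']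
  · simp [hi.ne']
  · simp only [hi.ne', hj.ne', Nat.add_eq_zero_iff, false_and, if_false, hqδ]
    push_cast
    linarith

/-- **Lemma 2.6.** If `R(h,t,θ)` satisfies the implicit equation
`R = ω f₁(ωh − R, t, θ) − ω^p d^{1/p}(ωh − R)^{1/p} v(θ) f(t)` with `|R| ≤ ωh/2`
for all large `h`, where `f₁(r,θ,t) = ω^{p-1} G(d^{1/p} r^{1/p} v(θ), t)`, then
`|D_h^i D_t^j R| ≤ C' h^{n(i)}` for `0 ≤ i+j ≤ 21` and `h` large, where
`n(0) = 1/p` and `n(i) = −i/q` for `i ≥ 1`. -/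
theorem R_estimates
    (p q a₁ b₁ d ω C : ℝ) (v v' f : ℝ → ℝ) (G : ℝ → ℝ → ℝ)
    (f₁ : ℝ → ℝ → ℝ → ℝ) (R : ℝ → ℝ → ℝ → ℝ)
    (hp : 2 ≤ p) (hq : q = p / (p - 1))
    (ha₁ : 0 < a₁) (hb₁ : 0 < b₁)
    (hab : a₁ ^ (-(1 : ℝ) / p) + b₁ ^ (-(1 : ℝ) / p) = 2)
    (hd : d = p / a₁) (hω : 0 < ω)
    -- `v`
    (hv : ∀ t, HasDerivAt v (v' t) t)
    (hode : ∀ t, HasDerivAt (fun s => phi p (v' s))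
      (-a₁ * phi p (max (v t) 0) + b₁ * phi p (max (-v t) 0)) t)
    (hv0 : v 0 = (p - 1) ^ (1 / p)) (hv'0 : v' 0 = 0)
    -- `f`, `G`
    (hf : ContDiff ℝ 23 f) (hfper : Function.Periodic f (2 * pip p))
    (hG : ContDiff ℝ 21 (fun z : ℝ × ℝ => G z.1 z.2))
    (hGper : ∀ x t, G x (t + 2 * pip p) = G x t)
    (hC : 0 < C)
    (hGbd : ∀ i j : ℕ, i + j ≤ 21 → ∀ x t : ℝ, |iterD G i j x t| ≤ C)
    -- `f₁`
    (hf₁ : ∀ r θ t : ℝ, f₁ r θ t = ω ^ (p - 1) * G (d ^ (1 / p) * r ^ (1 / p) * v θ) t)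
    -- the implicit equation for `R` and the a priori bound, for large `h`
    (hR : ∃ h₁ : ℝ, ∀ h : ℝ, h₁ ≤ h → ∀ t θ : ℝ,
      R h t θ = ω * f₁ (ω * h - R h t θ) θ t
        - ω ^ p * d ^ (1 / p) * (ω * h - R h t θ) ^ (1 / p) * v θ * f t ∧
      |R h t θ| ≤ ω * h / 2) :
    ∃ C' h₀ : ℝ, 0 < C' ∧ ∀ i j : ℕ, i + j ≤ 21 → ∀ θ t h : ℝ, h₀ ≤ h →
      |iterD (fun h t => R h t θ) i j h t| ≤ C' * h ^ nExp p q i := by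
  obtain ⟨V, hV⟩ := exists_bound_of_oscillator hp hq ha₁ hb₁ hv hode
  have hp0 : 0 < p := by linarith
  have hpip : 0 < 2 * pip p := by
    have hs : 0 < Real.sin (Real.pi / p) := by
      refine Real.sin_pos_of_pos_of_lt_pi (by positivity) ?_
      exact div_lt_self Real.pi_pos (by linarith)
    have : 0 < (p - 1) ^ (1 / p) := Real.rpow_pos_of_pos (by linarith) _
    unfold pip
    positivity
  have hfb : ∀ k ≤ 20 + 1, ∃ C, ∀ t, |iteratedDeriv k f t| ≤ C := fun k hk =>
    exists_bound_of_periodic hpip (periodic_iteratedDeriv hfper k)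
      (hf.continuous_iteratedDeriv k (by exact_mod_cast (by omega : k ≤ 23)))
  have hGB : HasBoundedPartials (20 + 1) (fun z : ℝ × ℝ => G z.1 z.2) :=
    HasBoundedPartials.of_iterD_bounded (by exact_mod_cast hG) hGbd
  set A := d ^ (1 / p) with hA
  set W := ω ^ p with hW
  obtain ⟨C₁, hC₁⟩ := hGB.2.2.1.bound
  obtain ⟨C₂, hC₂⟩ := hfb 0 (by norm_num)
  have hM : ∀ θ x t, |W * A * v θ * fderiv ℝ (fun z : ℝ × ℝ => G z.1 z.2) (x, t) (1, 0) -
      W * A * (v θ * f t)| ≤ |W * A| * V * (C₁ + C₂) := by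
    intro θ x t
    have V0 : 0 ≤ V := (abs_nonneg _).trans (hV 0)
    rw [show W * A * v θ * fderiv ℝ (fun z : ℝ × ℝ => G z.1 z.2) (x, t) (1, 0) -
      W * A * (v θ * f t) =
      W * A * v θ * (fderiv ℝ (fun z : ℝ × ℝ => G z.1 z.2) (x, t) (1, 0) - f t) by ring,
      abs_mul, abs_mul (W * A)]
    have h2 : |f t| ≤ C₂ := by simpa using hC₂ t
    have h3 := (abs_sub (fderiv ℝ (fun z : ℝ × ℝ => G z.1 z.2) (x, t) (1, 0)) (f t)).trans
      (add_le_add (hC₁ (x, t)) h2)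
    exact mul_le_mul (mul_le_mul_of_nonneg_left (hV θ) (abs_nonneg _)) h3 (abs_nonneg _)
      (by positivity)
  set M := |W * A| * V * (C₁ + C₂)
  set Y := max 1 M with hY
  have hY1 : 1 ≤ Y := le_max_left _ _
  obtain ⟨h₁, hR⟩ := hR
  set h₀ := max (max 1 h₁) (Y ^ p / (ω / 2)) with hh₀
  have h1 : 1 ≤ h₀ := (le_max_left _ _).trans (le_max_left _ _)
  have hlow : ∀ θ h t, h₀ < h → ω / 2 * h ≤ ω * h - R h t θ := fun θ h t hh => by
    have hle : h₁ ≤ h := ((le_max_right _ _).trans (le_max_left _ _)).trans hh.le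
    have := (abs_le.1 (hR h hle t θ).2).2
    linarith
  have hupp : ∀ θ h t, h₀ < h → ω * h - R h t θ ≤ 3 * ω / 2 * h := fun θ h t hh => by
    have hle : h₁ ≤ h := ((le_max_right _ _).trans (le_max_left _ _)).trans hh.le
    have := (abs_le.1 (hR h hle t θ).2).1
    linarith
  have hρ : ∀ θ h t, h₀ < h → 0 ≤ ω * h - R h t θ := fun θ h t hh =>
    (mul_nonneg (by positivity) (by linarith)).trans (hlow θ h t hh)
  have hRe : ∀ θ h t, h₀ < h → R h t θ =
      W * G (A * (ω * h - R h t θ) ^ (1 / p) * v θ) t -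
        W * A * ((ω * h - R h t θ) ^ (1 / p) * (v θ * f t)) := fun θ h t hh => by
    have hle : h₁ ≤ h := ((le_max_right _ _).trans (le_max_left _ _)).trans hh.le
    have h2 := (hR h hle t θ).1
    rw [hf₁] at h2
    have h3 : W = ω * ω ^ (p - 1) := by
      rw [hW, mul_comm, ← Real.rpow_add_one hω.ne']
      congr 1
      ring
    calc R h t θ = _ := h2
      _ = _ := by rw [← mul_assoc ω, ← h3]; ring
  have hsym := isSymbol_of_implicit (ω := ω) (A := A) (W := W) (V := V) (M := M) (Y := Y)
    (c₁ := (ω / 2) ^ (1 / p)) (c₂ := (3 * ω / 2) ^ (1 / p)) (h₀ := h₀) (n := 20)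
    (G := fun z : ℝ × ℝ => G z.1 z.2) (f := f) (v := v)
    (y := fun θ h t => (ω * h - R h t θ) ^ (1 / p)) hp hq hGB
    (hf.of_le (by norm_cast)) hfb hV hY1 (le_max_right _ _) h1
    (Real.rpow_pos_of_pos (by positivity) _) hM
    (fun θ h t hh => by
      have hYh : Y ^ p ≤ ω / 2 * h := by
        have := ((le_max_right _ _).trans_lt hh : Y ^ p / (ω / 2) < h).le
        rw [div_le_iff₀ (by positivity)] at this
        linarith
      have e : Y = (Y ^ p) ^ (1 / p) := by
        rw [one_div, Real.rpow_rpow_inv (by linarith) hp0.ne']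
      rw [e]
      exact Real.rpow_le_rpow (Real.rpow_nonneg (by linarith) _)
        (hYh.trans (hlow θ h t hh)) (by positivity))
    (fun θ h t hh => by
      have hh0 : 0 ≤ h := by linarith
      rw [← Real.mul_rpow (by positivity) hh0]
      exact Real.rpow_le_rpow (by positivity) (hlow θ h t hh) (by positivity))
    (fun θ h t hh => by
      have hh0 : 0 ≤ h := by linarith
      rw [← Real.mul_rpow (by positivity) hh0]
      exact Real.rpow_le_rpow (hρ θ h t hh) (hupp θ h t hh) (by positivity))
    (fun θ h t hh => by
      have e : ((ω * h - R h t θ) ^ (1 / p)) ^ p = ω * h - R h t θ := by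
        rw [one_div, Real.rpow_inv_rpow (hρ θ h t hh) hp0.ne']
      simp only
      rw [e, ← hRe θ h t hh]
      ring)
  have hRsym : IsSymbol h₀ 21 (nExp p q) (fun θ h t => R h t θ) :=
    hsym.congr fun θ h t hh => hRe θ h t hh
  have hex : ∀ i j : ℕ, ∃ C : ℝ, i + j ≤ 21 → ∀ θ h t, h₀ < h →
      |iterD (fun h t => R h t θ) i j h t| ≤ C * h ^ nExp p q i := fun i j => by
    by_cases hij : i + j ≤ 21
    · obtain ⟨C, hC⟩ := hRsym.iterD_bound hij
      exact ⟨C, fun _ => hC⟩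
    · exact ⟨0, fun h => absurd h hij⟩
  choose K hK using hex
  set S := ∑ i ∈ Finset.range 22, ∑ j ∈ Finset.range 22, |K i j|
  have hS : 0 ≤ S := Finset.sum_nonneg fun i _ => Finset.sum_nonneg fun j _ => abs_nonneg _
  refine ⟨S + 1, h₀ + 1, by linarith, fun i j hij θ t h hh => ?_⟩
  refine (hK i j hij θ h t (by linarith)).trans ?_
  have hpow : 0 ≤ h ^ nExp p q i := Real.rpow_nonneg (by linarith) _
  refine mul_le_mul_of_nonneg_right ?_ hpow
  have h2 : |K i j| ≤ ∑ j ∈ Finset.range 22, |K i j| :=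
    Finset.single_le_sum (f := fun j => |K i j|) (fun j _ => abs_nonneg _)
      (Finset.mem_range.2 (by omega))
  have h3 : ∑ j ∈ Finset.range 22, |K i j| ≤ S :=
    Finset.single_le_sum (f := fun i => ∑ j ∈ Finset.range 22, |K i j|)
      (fun i _ => Finset.sum_nonneg fun j _ => abs_nonneg _) (Finset.mem_range.2 (by omega))
  linarith [le_abs_self (K i j)]
end
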